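/- arXiv:1602.04731 — 2 statements merged into one kernel-verified Lean document; each statement's English description precedes it below -/
import Mathlib

section
/- Let n ≥ 1 be an integer and ζ a real transcendental number with w_n(ζ) finite, and assume equality holds in the left Khintchine transference inequality, i.e. λ_n(ζ) = w_n(ζ)/((n−1)·w_n(ζ) + n). Then λ̂_n(ζ) = 1/n and ŵ_n(ζ) = n. -/
open Polynomial

/-- Height of an integer polynomial: the maximum absolute value of its coefficients. -/
noncomputable def polyH (P : Polynomial ℤ) : ℝ :=
  (((P.support.sup fun i => (P.coeff i).natAbs) : ℕ) : ℝ)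

/-- Evaluation of an integer polynomial at a real number. -/
noncomputable def pev (ζ : ℝ) (P : Polynomial ℤ) : ℝ := Polynomial.aeval ζ P

/-- Set of exponents η such that for arbitrarily large X the system
    H(P) ≤ X, 0 < |P(ζ)| ≤ X^(−η) has a solution of degree at most n. -/
def wSet (n : ℕ) (ζ : ℝ) : Set ℝ :=
  {η | ∀ X₀ : ℝ, ∃ X : ℝ, X₀ ≤ X ∧ ∃ P : Polynomial ℤ,
    P.natDegree ≤ n ∧ polyH P ≤ X ∧ 0 < |pev ζ P| ∧ |pev ζ P| ≤ X ^ (-η)}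

/-- The exponent w_n(ζ). -/
noncomputable def wExp (n : ℕ) (ζ : ℝ) : ℝ := sSup (wSet n ζ)

/-- Set of exponents η such that for all sufficiently large X the system
    H(P) ≤ X, 0 < |P(ζ)| ≤ X^(−η) has a solution of degree at most n. -/
def whSet (n : ℕ) (ζ : ℝ) : Set ℝ :=
  {η | ∃ X₀ : ℝ, ∀ X : ℝ, X₀ ≤ X → ∃ P : Polynomial ℤ,
    P.natDegree ≤ n ∧ polyH P ≤ X ∧ 0 < |pev ζ P| ∧ |pev ζ P| ≤ X ^ (-η)}

/-- The uniform exponent ŵ_n(ζ). -/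
noncomputable def whExp (n : ℕ) (ζ : ℝ) : ℝ := sSup (whSet n ζ)

/-- Set of exponents η such that for arbitrarily large X the system
    |x| ≤ X, max_{1≤i≤n} |ζ^i x − y_i| ≤ X^(−η) has a nonzero integer solution. -/
def lamSet (n : ℕ) (ζ : ℝ) : Set ℝ :=
  {η | ∀ X₀ : ℝ, ∃ X : ℝ, X₀ ≤ X ∧ ∃ x : ℤ, ∃ y : Fin n → ℤ,
    (x ≠ 0 ∨ y ≠ 0) ∧ ((|x| : ℤ) : ℝ) ≤ X ∧
    ∀ i : Fin n, |ζ ^ ((i : ℕ) + 1) * (x : ℝ) - (y i : ℝ)| ≤ X ^ (-η)}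

/-- The exponent λ_n(ζ). -/
noncomputable def lamExp (n : ℕ) (ζ : ℝ) : ℝ := sSup (lamSet n ζ)

/-- Set of exponents η such that for all sufficiently large X the system
    |x| ≤ X, max_{1≤i≤n} |ζ^i x − y_i| ≤ X^(−η) has a nonzero integer solution. -/
def lamhSet (n : ℕ) (ζ : ℝ) : Set ℝ :=
  {η | ∃ X₀ : ℝ, ∀ X : ℝ, X₀ ≤ X → ∃ x : ℤ, ∃ y : Fin n → ℤ,
    (x ≠ 0 ∨ y ≠ 0) ∧ ((|x| : ℤ) : ℝ) ≤ X ∧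
    ∀ i : Fin n, |ζ ^ ((i : ℕ) + 1) * (x : ℝ) - (y i : ℝ)| ≤ X ^ (-η)}

/-- The uniform exponent λ̂_n(ζ). -/
noncomputable def lamhExp (n : ℕ) (ζ : ℝ) : ℝ := sSup (lamhSet n ζ)

/-- Set of exponents η such that for arbitrarily large X the polynomial system has
    at least j linearly independent solutions of degree at most n. -/
def wSetJ (n j : ℕ) (ζ : ℝ) : Set ℝ :=
  {η | ∀ X₀ : ℝ, ∃ X : ℝ, X₀ ≤ X ∧ ∃ P : Fin j → Polynomial ℤ,
    LinearIndependent ℤ P ∧ ∀ i : Fin j,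
      (P i).natDegree ≤ n ∧ polyH (P i) ≤ X ∧ 0 < |pev ζ (P i)| ∧ |pev ζ (P i)| ≤ X ^ (-η)}

/-- The exponent w_{n,j}(ζ). -/
noncomputable def wExpJ (n j : ℕ) (ζ : ℝ) : ℝ := sSup (wSetJ n j ζ)

/-- Set of exponents η such that for all sufficiently large X the polynomial system has
    at least j linearly independent solutions of degree at most n. -/
def whSetJ (n j : ℕ) (ζ : ℝ) : Set ℝ :=
  {η | ∃ X₀ : ℝ, ∀ X : ℝ, X₀ ≤ X → ∃ P : Fin j → Polynomial ℤ,
    LinearIndependent ℤ P ∧ ∀ i : Fin j,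
      (P i).natDegree ≤ n ∧ polyH (P i) ≤ X ∧ 0 < |pev ζ (P i)| ∧ |pev ζ (P i)| ≤ X ^ (-η)}

/-- The uniform exponent ŵ_{n,j}(ζ). -/
noncomputable def whExpJ (n j : ℕ) (ζ : ℝ) : ℝ := sSup (whSetJ n j ζ)

/-- Set of exponents η such that for arbitrarily large X the simultaneous approximation
    system has at least j linearly independent integer vector solutions. -/
def lamSetJ (n j : ℕ) (ζ : ℝ) : Set ℝ :=
  {η | ∀ X₀ : ℝ, ∃ X : ℝ, X₀ ≤ X ∧ ∃ v : Fin j → (Fin (n + 1) → ℤ),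
    LinearIndependent ℤ v ∧ ∀ i : Fin j,
      ((|v i 0| : ℤ) : ℝ) ≤ X ∧
      ∀ t : Fin n, |ζ ^ ((t : ℕ) + 1) * ((v i 0 : ℤ) : ℝ) - ((v i t.succ : ℤ) : ℝ)| ≤ X ^ (-η)}

/-- The exponent λ_{n,j}(ζ). -/
noncomputable def lamExpJ (n j : ℕ) (ζ : ℝ) : ℝ := sSup (lamSetJ n j ζ)

/-- Set of exponents η such that for all sufficiently large X the simultaneous approximation
    system has at least j linearly independent integer vector solutions. -/
def lamhSetJ (n j : ℕ) (ζ : ℝ) : Set ℝ :=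
  {η | ∃ X₀ : ℝ, ∀ X : ℝ, X₀ ≤ X → ∃ v : Fin j → (Fin (n + 1) → ℤ),
    LinearIndependent ℤ v ∧ ∀ i : Fin j,
      ((|v i 0| : ℤ) : ℝ) ≤ X ∧
      ∀ t : Fin n, |ζ ^ ((t : ℕ) + 1) * ((v i 0 : ℤ) : ℝ) - ((v i t.succ : ℤ) : ℝ)| ≤ X ^ (-η)}

/-- The uniform exponent λ̂_{n,j}(ζ). -/
noncomputable def lamhExpJ (n j : ℕ) (ζ : ℝ) : ℝ := sSup (lamhSetJ n j ζ)

/-- An extremal number: a real transcendental number with ŵ₂(ζ) = (3+√5)/2. -/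
def IsExtremal (ζ : ℝ) : Prop :=
  Transcendental ℚ ζ ∧ whExp 2 ζ = (3 + Real.sqrt 5) / 2


open MeasureTheory in
/-- **Minkowski's linear forms theorem**, strict version. -/
theorem Matrix.exists_ne_zero_int_abs_mulVec_lt {ι : Type*} [Fintype ι] [DecidableEq ι]
    (A : Matrix ι ι ℝ) (hA : A.det ≠ 0) (c : ι → ℝ) (hc : ∀ i, 0 < c i)
    (h : |A.det| < ∏ i, c i) :
    ∃ z : ι → ℤ, z ≠ 0 ∧ ∀ i, |(A.mulVec (fun k => (z k : ℝ))) i| < c i := by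
  let S : Set (ι → ℝ) := Set.univ.pi fun i => Set.Ioo (-c i) (c i)
  let b := Pi.basisFun ℝ ι
  have hF : volume (ZSpan.fundamentalDomain b) = 1 := by
    rw [ZSpan.fundamentalDomain_pi_basisFun, volume_pi, Measure.pi_pi]
    simp
  have hdet : LinearMap.det (Matrix.toLin' A) = A.det := LinearMap.det_toLin' A
  have hS : volume S = ENNReal.ofReal (2 ^ Fintype.card ι * ∏ i, c i) := by
    rw [volume_pi, Measure.pi_pi]
    simp_rw [Real.volume_Ioo]
    rw [← ENNReal.ofReal_prod_of_nonneg fun i _ => by linarith [hc i]]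
    congr 1
    rw [← Finset.card_univ, ← Finset.prod_const, ← Finset.prod_mul_distrib]
    exact Finset.prod_congr rfl fun i _ => by ring
  have hvol : volume (Matrix.toLin' A ⁻¹' S)
      = ENNReal.ofReal (|A.det|⁻¹ * (2 ^ Fintype.card ι * ∏ i, c i)) := by
    rw [Measure.addHaar_preimage_linearMap _ (by rwa [hdet]), hS, hdet,
      ← ENNReal.ofReal_mul (abs_nonneg _), abs_inv]
  have hconv : Convex ℝ (Matrix.toLin' A ⁻¹' S) :=
    (convex_pi fun i _ => convex_Ioo (-c i) (c i)).linear_preimage _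
  have hsymm : ∀ x ∈ Matrix.toLin' A ⁻¹' S, -x ∈ Matrix.toLin' A ⁻¹' S := by
    intro x hx i hi
    have := hx i hi
    simp only [map_neg, Pi.neg_apply, Set.mem_Ioo] at this ⊢
    constructor <;> linarith
  have : Countable (Submodule.span ℤ (Set.range b)).toAddSubgroup :=
    inferInstanceAs (Countable (Submodule.span ℤ (Set.range b)))
  obtain ⟨⟨x, hx⟩, hx0, hxS⟩ := exists_ne_zero_mem_lattice_of_measure_mul_two_pow_lt_measure
    (ZSpan.isAddFundamentalDomain' b volume) hsymm hconv (by
      rw [hF, hvol, one_mul, Module.finrank_fintype_fun_eq_card]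
      rw [← ENNReal.ofReal_ofNat 2, ← ENNReal.ofReal_pow (by norm_num)]
      refine ENNReal.ofReal_lt_ofReal_iff'.2 ⟨?_, ?_⟩
      · have hp : 0 < |A.det| := abs_pos.2 hA
        rw [inv_mul_eq_div, lt_div_iff₀ hp]
        gcongr
      · have : 0 < ∏ i, c i := Finset.prod_pos fun i _ => hc i
        positivity)
  have hint : ∀ i, ∃ m : ℤ, (m : ℝ) = x i := by
    have := (b.mem_span_iff_repr_mem ℤ x).1 hx
    intro i
    obtain ⟨m, hm⟩ := this i
    exact ⟨m, by simpa [b] using hm⟩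
  choose z hz using hint
  have hzx : (fun k => (z k : ℝ)) = x := funext hz
  refine ⟨z, ?_, fun i => ?_⟩
  · rintro rfl
    apply hx0
    ext i
    simp [← hzx]
  · rw [hzx, abs_lt]
    exact hxS i (Set.mem_univ i)

/-- The matrix of the linear forms `(x, y) ↦ (x, ζ x - y₁, …, ζⁿ x - yₙ)`. -/
def simMatrix (n : ℕ) (ζ : ℝ) : Matrix (Fin (n + 1)) (Fin (n + 1)) ℝ :=
  Matrix.of fun i k => (if k = 0 then ζ ^ (i : ℕ) else 0) - if k = i ∧ i ≠ 0 then 1 else 0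

/-- The matrix of the linear forms `(a₀, …, aₙ) ↦ (∑ aₖ ζᵏ, a₁, …, aₙ)`. -/
def polyMatrix (n : ℕ) (ζ : ℝ) : Matrix (Fin (n + 1)) (Fin (n + 1)) ℝ :=
  Matrix.of fun i k => if i = 0 then ζ ^ (k : ℕ) else if k = i then 1 else 0

theorem abs_det_simMatrix (n : ℕ) (ζ : ℝ) : |(simMatrix n ζ).det| = 1 := by
  rw [Matrix.det_of_isLowerTriangular, Finset.abs_prod]
  · refine Finset.prod_eq_one fun i _ => ?_
    by_cases hi : i = 0 <;> simp [simMatrix, hi]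
  · intro i k hik
    have hik : i < k := hik
    have h0 : k ≠ 0 := (Fin.pos_of_ne_zero (by rintro rfl; simp at hik)).ne'
    simp [simMatrix, h0, hik.ne']

theorem det_polyMatrix (n : ℕ) (ζ : ℝ) : (polyMatrix n ζ).det = 1 := by
  rw [Matrix.det_of_isUpperTriangular]
  · refine Finset.prod_eq_one fun i _ => ?_
    by_cases hi : i = 0 <;> simp [polyMatrix, hi]
  · intro i k hik
    have hik : k < i := hik
    have h0 : i ≠ 0 := by rintro rfl; simp at hik
    simp [polyMatrix, h0, hik.ne]

theorem simMatrix_mulVec_zero (n : ℕ) (ζ : ℝ) (v : Fin (n + 1) → ℝ) :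
    (simMatrix n ζ).mulVec v 0 = v 0 := by
  simp [simMatrix, Matrix.mulVec, dotProduct]

theorem simMatrix_mulVec_succ (n : ℕ) (ζ : ℝ) (v : Fin (n + 1) → ℝ) (i : Fin n) :
    (simMatrix n ζ).mulVec v i.succ = ζ ^ ((i : ℕ) + 1) * v 0 - v i.succ := by
  simp [simMatrix, Matrix.mulVec, dotProduct, sub_mul, Finset.sum_sub_distrib]

theorem polyMatrix_mulVec_zero (n : ℕ) (ζ : ℝ) (v : Fin (n + 1) → ℝ) :
    (polyMatrix n ζ).mulVec v 0 = ∑ k, v k * ζ ^ (k : ℕ) := by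
  simp [polyMatrix, Matrix.mulVec, dotProduct, mul_comm]

theorem polyMatrix_mulVec_succ (n : ℕ) (ζ : ℝ) (v : Fin (n + 1) → ℝ) (i : Fin n) :
    (polyMatrix n ζ).mulVec v i.succ = v i.succ := by
  simp [polyMatrix, Matrix.mulVec, dotProduct]

theorem polyH_le_iff {P : Polynomial ℤ} {X : ℝ} (hX : 0 ≤ X) :
    polyH P ≤ X ↔ ∀ i, |(P.coeff i : ℝ)| ≤ X := by
  rw [polyH, ← Nat.le_floor_iff hX, Finset.sup_le_iff]
  have key : ∀ i, (P.coeff i).natAbs ≤ ⌊X⌋₊ ↔ |(P.coeff i : ℝ)| ≤ X := fun i => by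
    rw [Nat.le_floor_iff hX, Nat.cast_natAbs, Int.cast_abs]
  refine ⟨fun h i => ?_, fun h i _ => (key i).2 (h i)⟩
  by_cases hi : i ∈ P.support
  · exact (key i).1 (h i hi)
  · simpa [Polynomial.notMem_support_iff.1 hi] using hX

theorem pev_eq_sum {n : ℕ} {P : Polynomial ℤ} (hP : P.natDegree ≤ n) (ζ : ℝ) :
    pev ζ P = ∑ k : Fin (n + 1), (P.coeff k : ℝ) * ζ ^ (k : ℕ) := by
  rw [pev, Polynomial.aeval_eq_sum_range' (Nat.lt_succ_of_le hP), ← Fin.sum_univ_eq_sum_range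
    (fun i => P.coeff i • ζ ^ i)]
  simp

/-- Duality between the values of a polynomial and simultaneous approximation:
`P(ζ) x = ∑ aₖ yₖ + ∑ aₖ (ζᵏ x - yₖ)` with `y₀ = x`. -/
theorem pev_mul_eq {n : ℕ} {P : Polynomial ℤ} (hP : P.natDegree ≤ n) (ζ x : ℝ) (y : Fin n → ℝ) :
    pev ζ P * x = (P.coeff 0 * x + ∑ i : Fin n, (P.coeff (i + 1) : ℝ) * y i)
      + ∑ i : Fin n, (P.coeff (i + 1) : ℝ) * (ζ ^ ((i : ℕ) + 1) * x - y i) := by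
  rw [pev_eq_sum hP, Fin.sum_univ_succ, add_mul, Finset.sum_mul, add_assoc,
    ← Finset.sum_add_distrib]
  congr 1
  · simp
  · exact Finset.sum_congr rfl fun i _ => by simp; ring

/-- If a polynomial `P` and positive bounds `c₀` (for `x`) and `c` (for the errors) satisfy
`|P(ζ)| c₀, |aᵢ| c < c₀ cⁿ`, there is a nonzero integer vector in the hyperplane orthogonal to `P`
satisfying these bounds up to a factor `n`. -/
theorem exists_simultaneous_of_poly {n : ℕ} (hn : 1 ≤ n) {ζ : ℝ} {P : Polynomial ℤ}
    (hP : P.natDegree ≤ n) (hP0 : 0 < |pev ζ P|) {c₀ c : ℝ} (hc₀ : 0 < c₀) (hc : 0 < c)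
    (h₀ : |pev ζ P| * c₀ < c₀ * c ^ n)
    (h₁ : ∀ i, |(P.coeff i : ℝ)| * c < c₀ * c ^ n) :
    ∃ z : Fin (n + 1) → ℤ, z ≠ 0 ∧ |(z 0 : ℝ)| ≤ n * c₀ ∧
      ∀ i : Fin n, |ζ ^ ((i : ℕ) + 1) * (z 0 : ℝ) - z i.succ| ≤ n * c := by
  let b : Fin (n + 1) → ℝ := Fin.cons (pev ζ P) fun i => -(P.coeff (i + 1) : ℝ)
  let d : Fin (n + 1) → ℝ := Fin.cons c₀ fun _ => c
  have hd : ∀ i, 0 < d i := fun i => by cases i using Fin.cases <;> simp [d, hc₀, hc]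
  have hdprod : ∏ i, d i = c₀ * c ^ n := by simp [d, Fin.prod_univ_succ]
  obtain ⟨j, -, hj⟩ := Finset.exists_max_image Finset.univ (fun i => |b i| * d i) ⟨0, by simp⟩
  have hbd : ∀ i, |b i| * d i < c₀ * c ^ n := fun i => by
    cases i using Fin.cases with
    | zero => simpa [b, d] using h₀
    | succ i => simpa [b, d] using h₁ (i + 1)
  have hjpos : 0 < |b j| * d j :=
    (mul_pos hP0 hc₀).trans_le (by simpa [b, d] using hj 0 (Finset.mem_univ _))
  have hbj : 0 < |b j| := pos_of_mul_pos_left hjpos (hd j).le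
  set U : Matrix (Fin (n + 1)) (Fin (n + 1)) ℝ := (1 : Matrix _ _ ℝ).updateRow j b with hU
  have hdetU : U.det = b j := by
    rw [hU, ← Matrix.cramer_transpose_apply, Matrix.transpose_one, Matrix.cramer_one]
    simp
  have hdet : |(U * simMatrix n ζ).det| = |b j| := by
    rw [Matrix.det_mul, abs_mul, abs_det_simMatrix, mul_one, hdetU]
  obtain ⟨z, hz0, hz⟩ := Matrix.exists_ne_zero_int_abs_mulVec_lt (U * simMatrix n ζ)
    (abs_pos.1 (hdet ▸ hbj)) (Function.update d j 1)
    (fun i => by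
      by_cases hi : i = j
      · subst hi; simp
      · simpa [hi] using hd i)
    (by
      rw [hdet, Finset.prod_update_of_mem (Finset.mem_univ j), one_mul]
      have := hbd j
      rw [← hdprod, ← Finset.mul_prod_erase _ _ (Finset.mem_univ j), mul_comm] at this
      rw [Finset.sdiff_singleton_eq_erase]
      exact lt_of_mul_lt_mul_left this (hd j).le)
  set u : Fin (n + 1) → ℝ := (simMatrix n ζ).mulVec fun k => (z k : ℝ) with hu
  simp_rw [← Matrix.mulVec_mulVec, ← hu] at hz
  have hu0 : u 0 = z 0 := simMatrix_mulVec_zero _ _ _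
  have hus : ∀ i : Fin n, u i.succ = ζ ^ ((i : ℕ) + 1) * (z 0 : ℝ) - z i.succ :=
    fun i => simMatrix_mulVec_succ _ _ _ _
  have hlt : ∀ i, i ≠ j → |u i| ≤ d i := fun i hi => by
    have := hz i
    rw [Function.update_of_ne hi, Matrix.mulVec, hU, Matrix.updateRow_ne hi] at this
    change |(Matrix.mulVec 1 u) i| < _ at this
    rw [Matrix.one_mulVec] at this
    exact this.le
  have hsum : ∑ i, b i * u i = 0 := by
    have h1 : |∑ i, b i * u i| < 1 := by
      have := hz j
      rwa [Function.update_self, Matrix.mulVec, hU, Matrix.updateRow_self] at this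
    have h2 : ∑ i, b i * u i
        = ((P.coeff 0 * z 0 + ∑ i : Fin n, P.coeff (i + 1) * z i.succ : ℤ) : ℝ) := by
      have := pev_mul_eq hP ζ (z 0) fun i => (z i.succ : ℝ)
      rw [Fin.sum_univ_succ, hu0]
      simp only [b, Fin.cons_zero, Fin.cons_succ, hus, this, neg_mul, Finset.sum_neg_distrib]
      push_cast
      ring
    rw [h2] at h1 ⊢
    have h3 : |P.coeff 0 * z 0 + ∑ i : Fin n, P.coeff (i + 1) * z i.succ| < 1 := by
      exact_mod_cast h1
    rw [Int.abs_lt_one_iff.1 h3, Int.cast_zero]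
  have hn1 : (1 : ℝ) ≤ n := by exact_mod_cast hn
  have hbound : ∀ i, |u i| ≤ n * d i := fun i => by
    by_cases hi : i = j
    · subst hi
      have h1 : b i * u i = -∑ k ∈ Finset.univ.erase i, b k * u k := by
        rw [eq_neg_iff_add_eq_zero, Finset.add_sum_erase _ (fun k => b k * u k)
          (Finset.mem_univ i), hsum]
      have h2 : |b i| * |u i| ≤ n * (|b i| * d i) := by
        rw [← abs_mul, h1, abs_neg]
        calc |∑ k ∈ Finset.univ.erase i, b k * u k|
            ≤ ∑ k ∈ Finset.univ.erase i, |b k * u k| := Finset.abs_sum_le_sum_abs _ _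
          _ ≤ ∑ k ∈ Finset.univ.erase i, |b i| * d i := Finset.sum_le_sum fun k hk => by
              rw [abs_mul]
              exact (mul_le_mul_of_nonneg_left (hlt k (Finset.ne_of_mem_erase hk))
                (abs_nonneg _)).trans (hj k (Finset.mem_univ _))
          _ = n * (|b i| * d i) := by simp
      exact le_of_mul_le_mul_left (by linarith) hbj
    · exact (hlt i hi).trans (le_mul_of_one_le_left (hd i).le hn1)
  refine ⟨z, hz0, ?_, fun i => ?_⟩
  · simpa [hu0, d] using hbound 0
  · simpa [hus, d] using hbound i.succ

open Filter in
theorem eventually_mul_rpow_lt {a b : ℝ} (hab : a < b) (C : ℝ) :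
    ∀ᶠ X : ℝ in atTop, C * X ^ a < X ^ b := by
  filter_upwards [(tendsto_rpow_atTop (sub_pos.2 hab)).eventually_gt_atTop C,
    eventually_gt_atTop 0] with X h h0
  have : X ^ b = X ^ (b - a) * X ^ a := by rw [← Real.rpow_add h0]; ring_nf
  rw [this]
  exact mul_lt_mul_of_pos_right h (Real.rpow_pos_of_pos h0 a)

theorem mem_whSet_iff_eventually {n : ℕ} {ζ η : ℝ} :
    η ∈ whSet n ζ ↔ ∀ᶠ X : ℝ in Filter.atTop, ∃ P : Polynomial ℤ,
      P.natDegree ≤ n ∧ polyH P ≤ X ∧ 0 < |pev ζ P| ∧ |pev ζ P| ≤ X ^ (-η) :=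
  Filter.eventually_atTop.symm

theorem mem_lamhSet_iff_eventually {n : ℕ} {ζ η : ℝ} :
    η ∈ lamhSet n ζ ↔ ∀ᶠ X : ℝ in Filter.atTop, ∃ x : ℤ, ∃ y : Fin n → ℤ,
      (x ≠ 0 ∨ y ≠ 0) ∧ ((|x| : ℤ) : ℝ) ≤ X ∧
      ∀ i : Fin n, |ζ ^ ((i : ℕ) + 1) * (x : ℝ) - (y i : ℝ)| ≤ X ^ (-η) :=
  Filter.eventually_atTop.symm

theorem whSet_subset_wSet (n : ℕ) (ζ : ℝ) : whSet n ζ ⊆ wSet n ζ := by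
  rintro η ⟨X₁, h⟩ X₀
  exact ⟨max X₀ X₁, le_max_left _ _, h _ (le_max_right _ _)⟩

theorem lamhSet_subset_lamSet (n : ℕ) (ζ : ℝ) : lamhSet n ζ ⊆ lamSet n ζ := by
  rintro η ⟨X₁, h⟩ X₀
  exact ⟨max X₀ X₁, le_max_left _ _, h _ (le_max_right _ _)⟩

theorem lamhSet_of_le {n : ℕ} {ζ η η' : ℝ} (h : η ∈ lamhSet n ζ) (hle : η' ≤ η) :
    η' ∈ lamhSet n ζ := by
  rw [mem_lamhSet_iff_eventually] at h ⊢
  filter_upwards [h, Filter.eventually_ge_atTop 1] with X ⟨x, y, h0, hx, hy⟩ hX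
  exact ⟨x, y, h0, hx, fun i => (hy i).trans
    (Real.rpow_le_rpow_of_exponent_le hX (by linarith))⟩

theorem ne_zero_or_of_ne_zero {n : ℕ} {z : Fin (n + 1) → ℤ} (hz : z ≠ 0) :
    z 0 ≠ 0 ∨ (fun i : Fin n => z i.succ) ≠ 0 := by
  by_contra! h
  exact hz (funext fun i => Fin.cases h.1 (fun i => congrFun h.2 i) i)

/-- A uniform exponent above `n` for polynomials yields a uniform exponent above `1 / n` for
simultaneous approximation. -/
theorem exists_mem_lamhSet_of_mem_whSet {n : ℕ} (hn : 1 ≤ n) {ζ η : ℝ} (hη : (n : ℝ) < η)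
    (h : η ∈ whSet n ζ) : ∃ κ ∈ lamhSet n ζ, 1 / (n : ℝ) < κ := by
  have hn0 : (0 : ℝ) < n := by exact_mod_cast hn
  set s : ℝ := (η / n - 1) / (2 * n * (η + 1)) with hs
  have hη0 : 0 < η := hn0.trans hη
  have hs1 : s * (2 * n * (η + 1)) = η / n - 1 := by rw [hs]; field_simp
  have hs0 : 0 < s := div_pos (sub_pos.2 ((one_lt_div hn0).2 hη)) (by positivity)
  set κ : ℝ := 1 / n + s with hκ
  set ξ : ℝ := 1 / n - n * s with hξ
  have hnκ : n * κ = 1 + n * s := by rw [hκ]; field_simp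
  have e1 : n * κ < ξ * η := by
    rw [hnκ, hξ]
    have h1 : (1 / n - n * s) * η = η / n - n * s * η := by ring
    have h2 : 0 < n * s * (η + 1) := by positivity
    rw [h1]
    nlinarith
  have e2 : ξ - κ < 1 - n * κ := by rw [hnκ, hξ, hκ]; linarith
  have hξ0 : 0 < ξ := by
    have : 0 < n * κ := by rw [hnκ]; positivity
    exact pos_of_mul_pos_left (this.trans e1) hη0.le
  refine ⟨κ, ?_, by linarith⟩
  rw [mem_whSet_iff_eventually] at h
  rw [mem_lamhSet_iff_eventually]
  filter_upwards [(tendsto_rpow_atTop hξ0).eventually h, Filter.eventually_gt_atTop 0,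
    eventually_mul_rpow_lt (neg_lt_neg e1) ((n : ℝ) ^ n),
    eventually_mul_rpow_lt e2 ((n : ℝ) ^ n)] with Y ⟨P, hP, hPH, hP0, hPζ⟩ hY h3 h4
  rw [polyH_le_iff (by positivity)] at hPH
  rw [← Real.rpow_mul hY.le, mul_neg] at hPζ
  have hpow : (Y ^ (-κ)) ^ n = Y ^ (-(n * κ)) := by
    rw [← Real.rpow_mul_natCast hY.le]; ring_nf
  have hnn : (0 : ℝ) < n ^ n := by positivity
  obtain ⟨z, hz0, hzx, hzy⟩ := exists_simultaneous_of_poly hn hP hP0 (c₀ := Y / n)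
    (c := Y ^ (-κ) / n) (by positivity) (by positivity)
    (by
      rw [mul_comm, div_pow, hpow]
      refine mul_lt_mul_of_pos_left (hPζ.trans_lt ?_) (by positivity)
      rwa [lt_div_iff₀' hnn])
    (fun i => by
      rw [div_pow, hpow]
      have h5 : Y ^ ξ * (Y ^ (-κ) / n) < Y / n * (Y ^ (-(n * κ)) / n ^ n) := by
        rw [sub_eq_add_neg, Real.rpow_add hY, sub_eq_add_neg, Real.rpow_add hY,
          Real.rpow_one] at h4
        rw [← mul_div_assoc, div_mul_eq_mul_div, ← mul_div_assoc]
        exact div_lt_div_of_pos_right ((lt_div_iff₀' hnn).2 h4) hn0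
      exact (mul_le_mul_of_nonneg_right (hPH i) (by positivity)).trans_lt h5)
  refine ⟨z 0, fun i => z i.succ, ne_zero_or_of_ne_zero hz0, ?_, fun i => ?_⟩
  · rw [mul_div_cancel₀ _ hn0.ne'] at hzx
    simpa using hzx
  · have := hzy i
    rwa [mul_div_cancel₀ _ hn0.ne'] at this

/-- Dirichlet's theorem for simultaneous approximation. -/
theorem mem_lamhSet_of_lt {n : ℕ} (hn : 1 ≤ n) (ζ : ℝ) {η : ℝ} (hη : η < 1 / n) :
    η ∈ lamhSet n ζ := by
  have hn0 : (0 : ℝ) < n := by exact_mod_cast hn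
  rw [mem_lamhSet_iff_eventually]
  have e : 0 < 1 - n * η := by rw [lt_div_iff₀' hn0] at hη; linarith
  filter_upwards [Filter.eventually_gt_atTop 0, eventually_mul_rpow_lt e 1] with X hX h1
  rw [Real.rpow_zero, mul_one, sub_eq_add_neg, Real.rpow_add hX, Real.rpow_one] at h1
  obtain ⟨z, hz0, hz⟩ := Matrix.exists_ne_zero_int_abs_mulVec_lt (simMatrix n ζ)
    (abs_pos.1 (by rw [abs_det_simMatrix]; exact one_pos)) (Fin.cons X fun _ => X ^ (-η))
    (fun i => by cases i using Fin.cases <;> simp [hX, Real.rpow_pos_of_pos])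
    (by
      rw [abs_det_simMatrix, Fin.prod_univ_succ]
      simp only [Fin.cons_zero, Fin.cons_succ, Finset.prod_const, Finset.card_univ,
        Fintype.card_fin]
      rw [← Real.rpow_mul_natCast hX.le]
      convert h1 using 3
      ring)
  refine ⟨z 0, fun i => z i.succ, ne_zero_or_of_ne_zero hz0, ?_, fun i => ?_⟩
  · have := hz 0
    rw [simMatrix_mulVec_zero] at this
    simpa using this.le
  · have := hz i.succ
    rw [simMatrix_mulVec_succ] at this
    simpa using this.le

theorem pev_ne_zero {ζ : ℝ} (hζ : Transcendental ℚ ζ) {P : Polynomial ℤ} (hP : P ≠ 0) :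
    pev ζ P ≠ 0 := fun h =>
  hP (transcendental_iff.1 (hζ.restrictScalars (R := ℤ) (S := ℚ) Int.cast_injective) P h)

/-- Dirichlet's theorem for values of polynomials. -/
theorem mem_whSet_of_lt {n : ℕ} {ζ : ℝ} (hζ : Transcendental ℚ ζ) {η : ℝ}
    (hη0 : 0 ≤ η) (hη : η < n) : η ∈ whSet n ζ := by
  rw [mem_whSet_iff_eventually]
  set C : ℝ := 1 + ∑ i : Fin n, |ζ| ^ ((i : ℕ) + 1) with hC
  have hC1 : 1 ≤ C := le_add_of_nonneg_right (Finset.sum_nonneg fun i _ => by positivity)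
  have hC0 : 0 < C := by linarith
  filter_upwards [Filter.eventually_ge_atTop C,
    eventually_mul_rpow_lt hη (C ^ n)] with X hXC h1
  have hX1 : 1 ≤ X := hC1.trans hXC
  have hX : 0 < X := by linarith
  obtain ⟨z, hz0, hz⟩ := Matrix.exists_ne_zero_int_abs_mulVec_lt (polyMatrix n ζ)
    (by rw [det_polyMatrix]; exact one_ne_zero) (Fin.cons (X ^ (-η)) fun _ => X / C)
    (fun i => by cases i using Fin.cases <;> simp <;> positivity)
    (by
      rw [det_polyMatrix, Fin.prod_univ_succ, abs_one]
      simp only [Fin.cons_zero, Fin.cons_succ, Finset.prod_const, Finset.card_univ,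
        Fintype.card_fin]
      rw [Real.rpow_neg hX.le, div_pow, ← div_eq_inv_mul, lt_div_iff₀ (by positivity), one_mul,
        lt_div_iff₀ (by positivity), mul_comm, ← Real.rpow_natCast X]
      exact h1)
  have hz1 := hz 0
  rw [polyMatrix_mulVec_zero, Fin.cons_zero] at hz1
  have hz2 : ∀ i : Fin n, |(z i.succ : ℝ)| ≤ X / C := fun i => by
    have := (hz i.succ).le
    rwa [polyMatrix_mulVec_succ, Fin.cons_succ] at this
  set P : Polynomial ℤ := ∑ k : Fin (n + 1), Polynomial.monomial (k : ℕ) (z k) with hPdef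
  have hcoeff : ∀ k : Fin (n + 1), P.coeff k = z k := fun k => by
    rw [hPdef, Polynomial.finsetSum_coeff]
    simp [Polynomial.coeff_monomial, Fin.val_inj]
  have hdeg : P.natDegree ≤ n := Polynomial.natDegree_sum_le_of_forall_le _ _ fun k _ =>
    (Polynomial.natDegree_monomial_le _).trans (Nat.lt_succ_iff.1 k.2)
  have hP0 : P ≠ 0 := fun h => hz0 (funext fun k => by rw [← hcoeff k, h]; simp)
  have hpev : pev ζ P = ∑ k, (z k : ℝ) * ζ ^ (k : ℕ) := by
    rw [pev_eq_sum hdeg]; simp_rw [hcoeff]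
  rw [← hpev] at hz1
  refine ⟨P, hdeg, (polyH_le_iff hX.le).2 fun i => ?_, abs_pos.2 (pev_ne_zero hζ hP0), hz1.le⟩
  have hz3 : |(z 0 : ℝ)| ≤ X := by
    have h2 : (z 0 : ℝ) = pev ζ P - ∑ i : Fin n, (z i.succ : ℝ) * ζ ^ ((i : ℕ) + 1) := by
      rw [hpev, Fin.sum_univ_succ]; simp
    have h3 : |pev ζ P| ≤ X / C := by
      refine hz1.le.trans ((Real.rpow_le_one_of_one_le_of_nonpos hX1 (by linarith)).trans ?_)
      rwa [one_le_div hC0]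
    calc |(z 0 : ℝ)| ≤ |pev ζ P| + |∑ i : Fin n, (z i.succ : ℝ) * ζ ^ ((i : ℕ) + 1)| := by
          rw [h2]; exact abs_sub _ _
      _ ≤ X / C + ∑ i : Fin n, X / C * |ζ| ^ ((i : ℕ) + 1) := by
          refine add_le_add h3 ((Finset.abs_sum_le_sum_abs _ _).trans
            (Finset.sum_le_sum fun i _ => ?_))
          rw [abs_mul, abs_pow]
          exact mul_le_mul_of_nonneg_right (hz2 i) (by positivity)
      _ = X / C * C := by rw [← Finset.mul_sum, hC]; ring
      _ = X := div_mul_cancel₀ _ hC0.ne'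
  by_cases hi : i < n + 1
  · have hk : ∀ k : Fin (n + 1), |(P.coeff k : ℝ)| ≤ X := fun k => by
      rw [hcoeff]
      cases k using Fin.cases with
      | zero => exact hz3
      | succ k => exact (hz2 k).trans (div_le_self hX.le hC1)
    exact hk ⟨i, hi⟩
  · rw [Polynomial.coeff_eq_zero_of_natDegree_lt (by omega)]
    simpa using hX.le

open Filter Topology in
/-- If `w_n(ζ)` is finite, a uniform exponent of simultaneous approximation above `1 / n` makes
the left Khintchine inequality strict. -/
theorem exists_mem_lamSet_gt {n : ℕ} (hn : 1 ≤ n) {ζ : ℝ} (hw : BddAbove (wSet n ζ))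
    (hne : (wSet n ζ).Nonempty) (hnw : (n : ℝ) ≤ wExp n ζ) {η₀ : ℝ} (hη₀ : 1 / (n : ℝ) < η₀)
    (h : η₀ ∈ lamhSet n ζ) :
    ∃ κ ∈ lamSet n ζ, wExp n ζ / (((n : ℝ) - 1) * wExp n ζ + n) < κ := by
  have hn1 : (1 : ℝ) ≤ n := by exact_mod_cast hn
  have hn0 : (0 : ℝ) < n := by linarith
  have hsup : wExp n ζ = sSup (wSet n ζ) := rfl
  set w := wExp n ζ
  have hw0 : 0 < w := hn0.trans_le hnw
  have hD : 0 < ((n : ℝ) - 1) * w + n := by nlinarith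
  set l := w / (((n : ℝ) - 1) * w + n) with hl
  have hle : 1 / (n : ℝ) < (1 + w) / w := by
    rw [div_lt_div_iff₀ hn0 hw0]; nlinarith
  obtain ⟨η, hη1, hη2⟩ := exists_between (lt_min hη₀ hle)
  have hη := lamhSet_of_le h (hη2.le.trans (min_le_left _ _))
  have hηw : η * w < 1 + w := (lt_div_iff₀ hw0).1 (hη2.trans_le (min_le_right _ _))
  have hnη : 1 < n * η := by rwa [div_lt_iff₀' hn0] at hη1
  have hlw : l * (1 + w - w * η) < w * η := by
    rw [hl, div_mul_eq_mul_div, div_lt_iff₀ hD]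
    nlinarith [mul_pos (mul_pos hw0 (by linarith : 0 < 1 + w)) (sub_pos.2 hnη)]
  have hev : ∀ᶠ ε : ℝ in 𝓝[>] 0, 0 < ε ∧ 0 < w - 2 * ε ∧ 1 < (w - 2 * ε) * η ∧
      0 < 1 - (w - 2 * ε) * η + w + 2 * ε ∧
      l * (1 - (w - 2 * ε) * η + w + 2 * ε) < (w - 2 * ε) * η := by
    have c1 : Continuous fun ε : ℝ => w - 2 * ε := by fun_prop
    have c2 : Continuous fun ε : ℝ => (w - 2 * ε) * η := by fun_prop
    have c3 : Continuous fun ε : ℝ => 1 - (w - 2 * ε) * η + w + 2 * ε := by fun_prop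
    have c4 : Continuous fun ε : ℝ => l * (1 - (w - 2 * ε) * η + w + 2 * ε) := by fun_prop
    refine (eventually_mem_nhdsWithin).and (Eventually.filter_mono nhdsWithin_le_nhds ?_)
    refine (continuousAt_const.eventually_lt c1.continuousAt ?_).and <|
      (continuousAt_const.eventually_lt c2.continuousAt ?_).and <|
      (continuousAt_const.eventually_lt c3.continuousAt ?_).and <|
      c4.continuousAt.eventually_lt c2.continuousAt ?_
    · simpa using hw0
    · simp only [mul_zero, sub_zero]; nlinarith
    · simp only [mul_zero, sub_zero, add_zero]; nlinarith
    · simp only [mul_zero, sub_zero, add_zero]; nlinarith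
  obtain ⟨ε, hε, hv0, hvη, hg, hlg⟩ := hev.exists
  set v := w - 2 * ε with hv
  set g := 1 - v * η + w + 2 * ε with hgdef
  refine ⟨v * η / g, ?_, (lt_div_iff₀ hg).2 hlg⟩
  obtain ⟨θ, hθ, hθw⟩ := exists_lt_of_lt_csSup hne
    (show w - ε < sSup (wSet n ζ) by rw [← hsup]; linarith)
  have hout : w + ε ∉ wSet n ζ := fun h => by
    have := le_csSup hw h
    rw [← hsup] at this
    linarith
  simp only [wSet, Set.mem_ofPred_eq, not_forall, not_exists, not_and, not_le] at hout
  obtain ⟨X₁, hX₁⟩ := hout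
  rw [mem_lamhSet_iff_eventually] at hη
  intro Y₀
  have hall := ((tendsto_rpow_atTop hv0).eventually hη).and <|
    ((tendsto_rpow_atTop hg).eventually_ge_atTop Y₀).and <|
    (eventually_ge_atTop X₁).and <| (eventually_ge_atTop 1).and <|
    (eventually_mul_rpow_lt (neg_lt_zero.2 hε) 2).and <|
    (eventually_mul_rpow_lt (sub_neg.2 hvη) (2 * n)).and <|
    eventually_mul_rpow_lt (show 1 - v * η + w + ε < g by rw [hgdef]; linarith) n
  obtain ⟨X₂, hX₂⟩ := eventually_atTop.1 hall
  obtain ⟨X, hXX, P, hP, hPH, hP0, hPθ⟩ := hθ X₂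
  obtain ⟨⟨x, y, hxy, hx, hy⟩, hY₀, hXX₁, hX1, h2, h3, h4⟩ := hX₂ X hXX
  have hX : 0 < X := by linarith
  rw [Real.rpow_zero] at h2 h3
  have hPlow : X ^ (-(w + ε)) < |pev ζ P| := hX₁ X hXX₁ P hP hPH hP0
  rw [polyH_le_iff hX.le] at hPH
  simp_rw [← Real.rpow_mul hX.le, mul_neg] at hy
  have herr : |∑ i : Fin n, (P.coeff (i + 1) : ℝ) * (ζ ^ ((i : ℕ) + 1) * x - y i)|
      ≤ n * X ^ (1 - v * η) := by
    calc |∑ i : Fin n, (P.coeff (i + 1) : ℝ) * (ζ ^ ((i : ℕ) + 1) * x - y i)|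
        ≤ ∑ i : Fin n, |(P.coeff (i + 1) : ℝ) * (ζ ^ ((i : ℕ) + 1) * x - y i)| :=
          Finset.abs_sum_le_sum_abs _ _
      _ ≤ ∑ i : Fin n, X ^ (1 - v * η) := Finset.sum_le_sum fun i _ => by
          rw [abs_mul, sub_eq_add_neg 1 (v * η), Real.rpow_add hX, Real.rpow_one]
          exact mul_le_mul (hPH _) (hy i) (abs_nonneg _) hX.le
      _ = n * X ^ (1 - v * η) := by simp
  have hPx : |pev ζ P * x| ≤ X ^ (-ε) := by
    rw [abs_mul]
    calc |pev ζ P| * |(x : ℝ)| ≤ X ^ (-θ) * X ^ v :=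
          mul_le_mul hPθ (by simpa using hx) (abs_nonneg _) (by positivity)
      _ = X ^ (-θ + v) := (Real.rpow_add hX _ _).symm
      _ ≤ X ^ (-ε) := Real.rpow_le_rpow_of_exponent_le hX1 (by linarith)
  have hid := pev_mul_eq hP ζ x fun i => (y i : ℝ)
  have hzero : (P.coeff 0 * x + ∑ i : Fin n, (P.coeff (i + 1) : ℝ) * y i) = 0 := by
    have h5 : |((P.coeff 0 * x + ∑ i : Fin n, P.coeff (i + 1) * y i : ℤ) : ℝ)| < 1 := by
      push_cast
      rw [← sub_eq_iff_eq_add.2 hid]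
      exact (abs_sub _ _).trans_lt (by linarith)
    have h6 : |P.coeff 0 * x + ∑ i : Fin n, P.coeff (i + 1) * y i| < 1 := by exact_mod_cast h5
    exact_mod_cast Int.abs_lt_one_iff.1 h6
  rw [hzero, zero_add] at hid
  refine ⟨X ^ g, hY₀, x, y, hxy, ?_, fun i => ?_⟩
  · have h5 : |pev ζ P| * |(x : ℝ)| ≤ n * X ^ (1 - v * η) := by rw [← abs_mul, hid]; exact herr
    have h6 : X ^ (-(w + ε)) * |(x : ℝ)| ≤ n * X ^ (1 - v * η) :=
      (mul_le_mul_of_nonneg_right hPlow.le (abs_nonneg _)).trans h5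
    rw [Real.rpow_neg hX.le, inv_mul_le_iff₀ (by positivity), mul_left_comm,
      ← Real.rpow_add hX] at h6
    rw [Int.cast_abs]
    refine h6.trans (le_of_eq_of_le ?_ h4.le)
    ring_nf
  · rw [← Real.rpow_mul hX.le, mul_neg, mul_div_cancel₀ _ hg.ne']
    exact hy i

theorem khintchine_left_equality_uniform (n : ℕ) (hn : 1 ≤ n) (ζ : ℝ)
    (hζ : Transcendental ℚ ζ)
    (hwfin : BddAbove (wSet n ζ))
    (heq : lamExp n ζ = wExp n ζ / (((n : ℝ) - 1) * wExp n ζ + n)) :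
    lamhExp n ζ = 1 / n ∧ whExp n ζ = n := by
  have hn1 : (1 : ℝ) ≤ n := by exact_mod_cast hn
  have hn0 : (0 : ℝ) < n := by linarith
  have hwh : BddAbove (whSet n ζ) := hwfin.mono (whSet_subset_wSet n ζ)
  have hwhne : (whSet n ζ).Nonempty := ⟨0, mem_whSet_of_lt hζ le_rfl hn0⟩
  have hwhn : (n : ℝ) ≤ whExp n ζ := le_of_forall_lt fun c hc => by
    obtain ⟨η, h1, h2⟩ := exists_between (max_lt hc hn0)
    exact ((le_max_left _ _).trans_lt h1).trans_le
      (le_csSup hwh (mem_whSet_of_lt hζ ((le_max_right _ _).trans h1.le) h2))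
  have hwne : (wSet n ζ).Nonempty := hwhne.mono (whSet_subset_wSet n ζ)
  have hnw : (n : ℝ) ≤ wExp n ζ :=
    hwhn.trans (csSup_le_csSup hwfin hwhne (whSet_subset_wSet n ζ))
  have hpos : 0 < wExp n ζ / (((n : ℝ) - 1) * wExp n ζ + n) :=
    div_pos (by linarith) (by nlinarith)
  have hlam : BddAbove (lamSet n ζ) := by
    by_contra hb
    rw [← heq, lamExp, Real.sSup_of_not_bddAbove hb] at hpos
    exact lt_irrefl _ hpos
  have hlamh : ∀ η ∈ lamhSet n ζ, η ≤ 1 / n := fun η hη => by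
    by_contra! hlt
    obtain ⟨κ, hκ, hκlt⟩ := exists_mem_lamSet_gt hn hwfin hwne hnw hlt hη
    rw [← heq] at hκlt
    exact hκlt.not_ge (le_csSup hlam hκ)
  refine ⟨le_antisymm ?_ ?_, le_antisymm ?_ hwhn⟩
  · exact csSup_le ⟨0, mem_lamhSet_of_lt hn ζ (by positivity)⟩ hlamh
  · exact le_of_forall_lt fun c hc => by
      obtain ⟨η, h1, h2⟩ := exists_between hc
      exact h1.trans_le (le_csSup ⟨_, hlamh⟩ (mem_lamhSet_of_lt hn ζ h2))
  · refine csSup_le hwhne fun η hη => ?_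
    by_contra! hlt
    obtain ⟨κ, hκ, hκlt⟩ := exists_mem_lamhSet_of_mem_whSet hn hlt hη
    exact hκlt.not_ge (hlamh κ hκ)
end

section
/- Let ζ be an extremal number. Then w_{4,4}(ζ) ≥ 2 + √5, i.e. for every η < 2 + √5 and arbitrarily large X the system H(P) ≤ X, 0 < |P(ζ)| ≤ X^{−η} has at least 4 linearly independent solutions P ∈ ℤ[T] of degree at most 4. -/
open Polynomial

/-- Height of a coefficient vector `(v₀, v₁, v₂)`. -/
def ht (v : Fin 3 → ℤ) : ℕ := Finset.univ.sup fun i => (v i).natAbs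

/-- Value at `ζ` of the polynomial `v₀ + v₁ T + v₂ T²`. -/
def lf {R : Type*} [CommRing R] (ζ : R) (v : Fin 3 → ℤ) : R := v 0 + v 1 * ζ + v 2 * ζ ^ 2

/-- Resultant of two quadratic forms, written with the coordinates of the cross product. -/
def res (P Q : Fin 3 → ℤ) : ℤ :=
  (P 2 * Q 0 - P 0 * Q 2) ^ 2 - (P 1 * Q 2 - P 2 * Q 1) * (P 0 * Q 1 - P 1 * Q 0)

/-- Determinant of three coefficient vectors. -/
def det3 (P Q R : Fin 3 → ℤ) : ℤ :=
  (P 1 * Q 2 - P 2 * Q 1) * R 0 + (P 2 * Q 0 - P 0 * Q 2) * R 1 + (P 0 * Q 1 - P 1 * Q 0) * R 2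

/-- `P` and `Q` are proportional: all their `2 × 2` minors vanish. -/
def Prop2 (P Q : Fin 3 → ℤ) : Prop :=
  P 1 * Q 2 - P 2 * Q 1 = 0 ∧ P 2 * Q 0 - P 0 * Q 2 = 0 ∧ P 0 * Q 1 - P 1 * Q 0 = 0

lemma natAbs_le_ht (v : Fin 3 → ℤ) (i : Fin 3) : (v i).natAbs ≤ ht v :=
  Finset.le_sup (f := fun i => (v i).natAbs) (Finset.mem_univ i)

lemma abs_le_ht (v : Fin 3 → ℤ) (i : Fin 3) : |(v i : ℝ)| ≤ ht v := by
  have h := natAbs_le_ht v i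
  rw [← Int.cast_abs, Int.abs_eq_natAbs]
  exact_mod_cast h

lemma exists_abs_eq_ht (v : Fin 3 → ℤ) : ∃ i, |(v i : ℝ)| = ht v := by
  obtain ⟨i, -, hi⟩ := Finset.exists_mem_eq_sup Finset.univ Finset.univ_nonempty
    fun i => (v i).natAbs
  refine ⟨i, ?_⟩
  rw [← Int.cast_abs, Int.abs_eq_natAbs, ht, hi]
  rfl

lemma one_le_ht {v : Fin 3 → ℤ} (hv : v ≠ 0) : 1 ≤ ht v := by
  obtain ⟨i, hi⟩ := Function.ne_iff.mp hv
  exact (Int.natAbs_pos.mpr hi).trans_le (natAbs_le_ht v i)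

lemma lf_ne_zero {ζ : ℝ} (hζ : Transcendental ℚ ζ) {v : Fin 3 → ℤ} (hv : v ≠ 0) :
    lf ζ v ≠ 0 := by
  intro h
  have hζ' : Transcendental ℤ ζ := fun h => hζ (h.extendScalars (Int.cast_injective))
  have h0 := (transcendental_iff.mp hζ') (C (v 0) + C (v 1) * X + C (v 2) * X ^ 2) (by
    simpa [lf] using h)
  apply hv
  ext i
  have hc := congrArg (fun p => Polynomial.coeff p (i : ℕ)) h0
  fin_cases i <;> simpa [coeff_X, coeff_C, -eq_intCast] using hc

lemma abs_lf_le (ζ : ℝ) (v : Fin 3 → ℤ) : |lf ζ v| ≤ (1 + |ζ| + ζ ^ 2) * ht v := by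
  have h0 := abs_le_ht v 0
  have h1 := abs_le_ht v 1
  have h2 := abs_le_ht v 2
  calc |lf ζ v| ≤ |(v 0 : ℝ)| + |(v 1 : ℝ)| * |ζ| + |(v 2 : ℝ)| * ζ ^ 2 := by
        rw [lf]
        refine (abs_add_three _ _ _).trans (le_of_eq ?_)
        rw [abs_mul, abs_mul, abs_of_nonneg (sq_nonneg ζ)]
    _ ≤ ht v + ht v * |ζ| + ht v * ζ ^ 2 := by gcongr
    _ = _ := by ring

/-- A sequence of minimal points for the pair (height, value at `ζ`). -/
structure IsMinSeq (ζ : ℝ) (P : ℕ → Fin 3 → ℤ) : Prop where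
  ne_zero : ∀ k, P k ≠ 0
  ht_mono : StrictMono fun k => ht (P k)
  lf_anti : StrictAnti fun k => |lf ζ (P k)|
  le_lf : ∀ k v, v ≠ 0 → ht v < ht (P (k + 1)) → |lf ζ (P k)| ≤ |lf ζ v|

lemma exists_min_of_ht_le (ζ : ℝ) {N : ℕ} (hN : 1 ≤ N) :
    ∃ p : Fin 3 → ℤ, (p ≠ 0 ∧ ht p ≤ N) ∧ ∀ v, v ≠ 0 → ht v ≤ N → |lf ζ p| ≤ |lf ζ v| := by
  have hfin : {v : Fin 3 → ℤ | v ≠ 0 ∧ ht v ≤ N}.Finite := by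
    refine (Set.finite_Icc (fun _ : Fin 3 => -(N : ℤ)) (fun _ => (N : ℤ))).subset ?_
    rintro v ⟨-, hv⟩
    constructor <;> intro i <;> have := natAbs_le_ht v i <;> simp only <;> omega
  have hne : {v : Fin 3 → ℤ | v ≠ 0 ∧ ht v ≤ N}.Nonempty := by
    refine ⟨fun _ => 1, fun h => by simpa using congrFun h 0, ?_⟩
    refine (Finset.sup_le fun i _ => ?_).trans hN
    simp
  obtain ⟨p, hp, hmin⟩ := Set.exists_min_image _ (fun v => |lf ζ v|) hfin hne
  exact ⟨p, hp, fun v h0 hv => hmin v ⟨h0, hv⟩⟩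

lemma exists_isMinSeq {ζ : ℝ} (hζ : Transcendental ℚ ζ)
    (hsmall : ∀ δ > 0, ∃ v : Fin 3 → ℤ, v ≠ 0 ∧ |lf ζ v| < δ) : ∃ P, IsMinSeq ζ P := by
  have step (p : {p : Fin 3 → ℤ // p ≠ 0 ∧ ∀ v, v ≠ 0 → ht v ≤ ht p → |lf ζ p| ≤ |lf ζ v|}) :
      ∃ q : {p : Fin 3 → ℤ // p ≠ 0 ∧ ∀ v, v ≠ 0 → ht v ≤ ht p → |lf ζ p| ≤ |lf ζ v|},
        ht p.1 < ht q.1 ∧ |lf ζ q.1| < |lf ζ p.1| ∧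
        ∀ v, v ≠ 0 → ht v < ht q.1 → |lf ζ p.1| ≤ |lf ζ v| := by
    obtain ⟨p, hp0, hp⟩ := p
    have hex : ∃ N, ∃ v : Fin 3 → ℤ, v ≠ 0 ∧ ht v = N ∧ |lf ζ v| < |lf ζ p| := by
      obtain ⟨v, hv0, hv⟩ := hsmall _ (abs_pos.mpr (lf_ne_zero hζ hp0))
      exact ⟨_, v, hv0, rfl, hv⟩
    classical
    obtain ⟨v, hv0, hvN, hv⟩ := Nat.find_spec hex
    obtain ⟨q, ⟨hq0, hqN⟩, hq⟩ := exists_min_of_ht_le ζ (hvN ▸ one_le_ht hv0)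
    have hqp : |lf ζ q| < |lf ζ p| := (hq v hv0 hvN.le).trans_lt hv
    have hqN' : ht q = Nat.find hex := hqN.antisymm (Nat.find_min' hex ⟨q, hq0, rfl, hqp⟩)
    refine ⟨⟨q, hq0, fun w hw h => hq w hw (h.trans hqN)⟩, ?_, hqp, fun w hw h => ?_⟩
    · by_contra! h
      exact (hp q hq0 h).not_gt hqp
    · by_contra! h'
      exact Nat.find_min hex (hqN' ▸ h) ⟨w, hw, rfl, h'⟩
  choose f hf using step
  obtain ⟨p, ⟨hp0, hp1⟩, hp⟩ := exists_min_of_ht_le ζ le_rfl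
  let g : ℕ → {p : Fin 3 → ℤ // p ≠ 0 ∧ ∀ v, v ≠ 0 → ht v ≤ ht p → |lf ζ p| ≤ |lf ζ v|} :=
    fun k => f^[k] ⟨p, hp0, fun v hv h => hp v hv (h.trans hp1)⟩
  have hg (k : ℕ) : g (k + 1) = f (g k) := Function.iterate_succ_apply' _ _ _
  refine ⟨fun k => (g k).1, fun k => (g k).2.1, strictMono_nat_of_lt_succ fun k => ?_,
    strictAnti_nat_of_succ_lt fun k => ?_, fun k v hv h => ?_⟩
  · simp only [hg]
    exact (hf _).1
  · simp only [hg]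
    exact (hf _).2.1
  · simp only [hg] at h
    exact (hf _).2.2 v hv h

/-! ### Determinants and resultants -/

lemma one_le_abs_cast {n : ℤ} (hn : n ≠ 0) : (1 : ℝ) ≤ |(n : ℝ)| := by
  exact_mod_cast Int.one_le_abs hn

lemma abs_minor_le {a b c d A B : ℝ} (ha : |a| ≤ A) (hb : |b| ≤ B) (hc : |c| ≤ A) (hd : |d| ≤ B) :
    |a * b - c * d| ≤ 2 * A * B := by
  have hA := (abs_nonneg a).trans ha
  calc |a * b - c * d| ≤ |a * b| + |c * d| := abs_sub _ _
    _ = |a| * |b| + |c| * |d| := by rw [abs_mul, abs_mul]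
    _ ≤ A * B + A * B := by gcongr
    _ = _ := by ring

lemma one_le_of_det3_ne_zero {ζ : ℝ} {P Q R : Fin 3 → ℤ} (h : det3 P Q R ≠ 0)
    (hPQ : ht P ≤ ht Q) (hQR : ht Q ≤ ht R) (hQP : |lf ζ Q| ≤ |lf ζ P|)
    (hRP : |lf ζ R| ≤ |lf ζ P|) : 1 ≤ 6 * |lf ζ P| * ht Q * ht R := by
  have hPQ' : (ht P : ℝ) ≤ ht Q := by exact_mod_cast hPQ
  have hQR' : (ht Q : ℝ) ≤ ht R := by exact_mod_cast hQR
  have e : (det3 P Q R : ℝ) = lf ζ P * (Q 1 * R 2 - Q 2 * R 1) - lf ζ Q * (P 1 * R 2 - P 2 * R 1)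
      + lf ζ R * (P 1 * Q 2 - P 2 * Q 1) := by
    simp only [det3, lf]; push_cast; ring
  have h1 := abs_minor_le (abs_le_ht Q 1) (abs_le_ht R 2) (abs_le_ht Q 2) (abs_le_ht R 1)
  have h2 := abs_minor_le (abs_le_ht P 1) (abs_le_ht R 2) (abs_le_ht P 2) (abs_le_ht R 1)
  have h3 := abs_minor_le (abs_le_ht P 1) (abs_le_ht Q 2) (abs_le_ht P 2) (abs_le_ht Q 1)
  calc (1 : ℝ) ≤ |(det3 P Q R : ℝ)| := one_le_abs_cast h
    _ ≤ |lf ζ P| * |(Q 1 * R 2 - Q 2 * R 1 : ℝ)| + |lf ζ Q| * |(P 1 * R 2 - P 2 * R 1 : ℝ)|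
        + |lf ζ R| * |(P 1 * Q 2 - P 2 * Q 1 : ℝ)| := by
      rw [e, ← abs_mul, ← abs_mul, ← abs_mul]
      exact (abs_add_le _ _).trans (by gcongr; exact abs_sub _ _)
    _ ≤ |lf ζ P| * (2 * ht Q * ht R) + |lf ζ P| * (2 * ht P * ht R)
        + |lf ζ P| * (2 * ht P * ht Q) := by gcongr
    _ ≤ |lf ζ P| * (2 * ht Q * ht R) + |lf ζ P| * (2 * ht Q * ht R)
        + |lf ζ P| * (2 * ht Q * ht R) := by gcongr
    _ = _ := by ring

lemma one_le_of_res_ne_zero (ζ : ℝ) : ∃ K : ℝ, 1 ≤ K ∧ ∀ P Q : Fin 3 → ℤ, res P Q ≠ 0 →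
    ht P ≤ ht Q → |lf ζ Q| ≤ |lf ζ P| → 1 ≤ K * |lf ζ P| * ht P * ht Q ^ 2 := by
  refine ⟨4 * (2 * |ζ| + 1) + 4 * (1 + |ζ| + ζ ^ 2), by
    have := abs_nonneg ζ; nlinarith [sq_nonneg ζ], fun P Q h hPQ hQP => ?_⟩
  have hPQ' : (ht P : ℝ) ≤ ht Q := by exact_mod_cast hPQ
  set n : ℝ := P 1 * Q 2 - P 2 * Q 1 with hn
  set e₁ : ℝ := lf ζ Q * P 2 - lf ζ P * Q 2 with he₁
  set e₂ : ℝ := lf ζ P * Q 1 - lf ζ Q * P 1 with he₂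
  have e : (res P Q : ℝ) = 2 * ζ * n * e₁ + e₁ ^ 2 - n * e₂ := by
    simp only [res, hn, he₁, he₂, lf]; push_cast; ring
  have hn' : |n| ≤ 2 * ht P * ht Q :=
    abs_minor_le (abs_le_ht P 1) (abs_le_ht Q 2) (abs_le_ht P 2) (abs_le_ht Q 1)
  have he₁' : |e₁| ≤ 2 * |lf ζ P| * ht Q :=
    abs_minor_le hQP ((abs_le_ht P 2).trans hPQ') le_rfl (abs_le_ht Q 2)
  have he₂' : |e₂| ≤ 2 * |lf ζ P| * ht Q :=
    abs_minor_le le_rfl (abs_le_ht Q 1) hQP ((abs_le_ht P 1).trans hPQ')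
  calc (1 : ℝ) ≤ |(res P Q : ℝ)| := one_le_abs_cast h
    _ ≤ 2 * |ζ| * |n| * |e₁| + |e₁| ^ 2 + |n| * |e₂| := by
      rw [e]
      refine (abs_sub _ _).trans ?_
      rw [abs_mul n]
      gcongr
      refine (abs_add_le _ _).trans (le_of_eq ?_)
      simp [abs_mul]
    _ ≤ 2 * |ζ| * (2 * ht P * ht Q) * (2 * |lf ζ P| * ht Q)
        + (2 * |lf ζ P| * ht Q) * (2 * |lf ζ P| * ht Q)
        + (2 * ht P * ht Q) * (2 * |lf ζ P| * ht Q) := by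
      rw [sq |e₁|]; gcongr
    _ ≤ 2 * |ζ| * (2 * ht P * ht Q) * (2 * |lf ζ P| * ht Q)
        + (2 * ((1 + |ζ| + ζ ^ 2) * ht P) * ht Q) * (2 * |lf ζ P| * ht Q)
        + (2 * ht P * ht Q) * (2 * |lf ζ P| * ht Q) := by
      have := abs_lf_le ζ P
      gcongr
    _ = _ := by ring

/-! ### Rational roots -/

/-- `P` has no rational root on the projective line. -/
def NoRoot (P : Fin 3 → ℤ) : Prop :=
  ∀ s t : ℤ, s ≠ 0 ∨ t ≠ 0 → P 0 * s ^ 2 + P 1 * s * t + P 2 * t ^ 2 ≠ 0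

lemma exists_factor {P : Fin 3 → ℤ} {s t : ℤ} (hst : IsCoprime s t)
    (h : P 0 * s ^ 2 + P 1 * s * t + P 2 * t ^ 2 = 0) :
    ∃ c d : ℤ, P 0 = -t * d ∧ P 1 = s * d - t * c ∧ P 2 = s * c := by
  obtain ⟨c, hc⟩ : s ∣ P 2 := (hst.pow_right (n := 2)).dvd_of_dvd_mul_right
    ⟨-(P 0 * s + P 1 * t), by linear_combination h⟩
  obtain ⟨e, he⟩ : t ∣ P 0 := (hst.symm.pow_right (n := 2)).dvd_of_dvd_mul_right
    ⟨-(P 2 * t + P 1 * s), by linear_combination h⟩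
  rcases eq_or_ne s 0 with rfl | hs
  · obtain ⟨u, v, huv⟩ := hst
    have ht : t * t = 1 := by
      rcases Int.isUnit_iff.mp (IsUnit.of_mul_eq_one v (by linear_combination huv : t * v = 1))
        with rfl | rfl <;> rfl
    exact ⟨-P 1 * t, -P 0 * t, by linear_combination -P 0 * ht,
      by linear_combination -P 1 * ht, by linear_combination hc⟩
  rcases eq_or_ne t 0 with rfl | ht
  · obtain ⟨u, v, huv⟩ := hst
    have hs : s * s = 1 := by
      rcases Int.isUnit_iff.mp (IsUnit.of_mul_eq_one u (by linear_combination huv : s * u = 1))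
        with rfl | rfl <;> rfl
    exact ⟨c, P 1 * s, by linear_combination he, by linear_combination -P 1 * hs, hc⟩
  · refine ⟨c, -e, by linear_combination he, ?_, hc⟩
    have := mul_ne_zero hs ht
    apply mul_left_cancel₀ this
    linear_combination h - s ^ 2 * he - t ^ 2 * hc

lemma ht_mul_ht_le {P : Fin 3 → ℤ} {s t c d : ℤ} (h0 : P 0 = -t * d) (h1 : P 1 = s * d - t * c)
    (h2 : P 2 = s * c) : (ht ![-t, s, 0] : ℝ) * ht ![d, c, 0] ≤ 2 * ht P := by
  have a0 := abs_le_ht P 0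
  have a1 := abs_le_ht P 1
  have a2 := abs_le_ht P 2
  rw [h0] at a0; rw [h1] at a1; rw [h2] at a2
  push_cast at a0 a1 a2
  have hH : (0 : ℝ) ≤ ht P := Nat.cast_nonneg _
  generalize (ht P : ℝ) = H at *
  have key : ∀ x y : ℝ, |x - y| ≤ H → |x * y| ≤ H ^ 2 → |x| ≤ 2 * H := by
    intro x y hxy hm
    by_contra! hx
    have hy : H < |y| := by have := abs_sub_abs_le_abs_sub x y; linarith
    rw [abs_mul] at hm
    nlinarith
  have hp : |(s * d : ℝ) * (t * c)| ≤ H ^ 2 := by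
    rw [show (s * d : ℝ) * (t * c) = -((-t * d) * (s * c)) by ring, abs_neg, abs_mul, sq]
    gcongr
  obtain ⟨i, hi⟩ := exists_abs_eq_ht ![-t, s, 0]
  obtain ⟨j, hj⟩ := exists_abs_eq_ht ![d, c, 0]
  rw [← hi, ← hj, ← abs_mul]
  fin_cases i <;> fin_cases j <;> simp only [Fin.zero_eta, Fin.mk_one, Fin.reduceFinMk,
    Matrix.cons_val_zero, Matrix.cons_val_one, Matrix.cons_val, Int.cast_zero, Int.cast_neg,
    mul_zero, zero_mul, abs_zero] <;> try positivity
  · linarith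
  · rw [neg_mul, abs_neg]
    exact key _ (s * d) (by rwa [abs_sub_comm]) (by rwa [mul_comm])
  · exact key _ _ a1 hp
  · linarith

section

variable {ζ : ℝ} {P : ℕ → Fin 3 → ℤ}

lemma vec_ne_zero {a b : ℤ} (h : a ≠ 0 ∨ b ≠ 0) : ![a, b, 0] ≠ 0 := by
  rintro h'
  have h0 := congrFun h' 0
  have h1 := congrFun h' 1
  simp at h0 h1
  tauto

lemma exists_coprime_lower (hζ : Transcendental ℚ ζ) (hP : IsMinSeq ζ P)
    (hlim : ∀ ε > 0, ∃ k₀, ∀ k ≥ k₀, |lf ζ (P k)| * ht (P (k + 1)) ^ 2 ≤ ε) :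
    ∃ c > 0, ∀ a b : ℤ, IsCoprime a b → c ≤ |lf ζ ![a, b, 0]| * ht ![a, b, 0] ^ 2 := by
  obtain ⟨k₀, hk₀⟩ := hlim (1 / 16) (by norm_num)
  set j₀ := 2 * ht (P k₀)
  have hL : 0 < |lf ζ (P j₀)| := abs_pos.mpr (lf_ne_zero hζ (hP.ne_zero _))
  have hc : 0 < 1 / (4 * (2 + 2 * |ζ|)) := by positivity
  refine ⟨min |lf ζ (P j₀)| (1 / (4 * (2 + 2 * |ζ|))), lt_min hL hc, fun a b hab => ?_⟩
  have hab0 : a ≠ 0 ∨ b ≠ 0 := by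
    by_contra! h
    obtain ⟨u, v, huv⟩ := hab
    simp [h.1, h.2] at huv
  have hv0 := vec_ne_zero hab0
  have hα : lf ζ ![a, b, 0] = a + b * ζ := by simp [lf]
  have ha : |(a : ℝ)| ≤ ht ![a, b, 0] := abs_le_ht ![a, b, 0] 0
  have hb : |(b : ℝ)| ≤ ht ![a, b, 0] := abs_le_ht ![a, b, 0] 1
  have hM1 : (1 : ℝ) ≤ ht ![a, b, 0] := by exact_mod_cast one_le_ht hv0
  rcases le_or_gt (ht ![a, b, 0]) (2 * ht (P k₀)) with hM | hM
  · refine (min_le_left _ _).trans ?_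
    have h1 : |lf ζ (P j₀)| ≤ |lf ζ ![a, b, 0]| :=
      hP.le_lf j₀ _ hv0 (hM.trans_lt ((Nat.lt_succ_self _).trans_le (hP.ht_mono.id_le _)))
    exact h1.trans (le_mul_of_one_le_right (abs_nonneg _) (one_le_pow₀ hM1))
  · refine (min_le_right _ _).trans ?_
    by_contra! hlt
    have hex : ∃ n, ht ![a, b, 0] ≤ 2 * ht (P n) :=
      ⟨ht ![a, b, 0], by have := hP.ht_mono.id_le (ht ![a, b, 0]); simp only [id] at this; omega⟩
    have hspec := Nat.find_spec hex
    have hgt : k₀ < Nat.find hex := by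
      by_contra! h
      have : ht (P (Nat.find hex)) ≤ ht (P k₀) := hP.ht_mono.monotone h
      omega
    obtain ⟨j, hj⟩ : ∃ j, Nat.find hex = j + 1 := ⟨Nat.find hex - 1, by omega⟩
    have hjm : 2 * ht (P j) < ht ![a, b, 0] := by
      have := Nat.find_min hex (m := j) (by omega)
      omega
    rw [hj] at hspec
    have hLj := hk₀ j (by omega)
    have hjm' : (2 : ℝ) * ht (P j) < ht ![a, b, 0] := by exact_mod_cast hjm
    have hspec' : (ht ![a, b, 0] : ℝ) ≤ 2 * ht (P (j + 1)) := by exact_mod_cast hspec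
    have hres : P j 0 * b ^ 2 + P j 1 * b * (-a) + P j 2 * (-a) ^ 2 = 0 := by
      by_contra hne
      have h1 := one_le_abs_cast hne
      have e : ((P j 0 * b ^ 2 + P j 1 * b * (-a) + P j 2 * (-a) ^ 2 : ℤ) : ℝ)
          = b ^ 2 * lf ζ (P j) - (P j 1 * b * lf ζ ![a, b, 0]
            + 2 * P j 2 * b * ζ * lf ζ ![a, b, 0] - P j 2 * lf ζ ![a, b, 0] ^ 2) := by
        rw [hα, lf]; push_cast; ring
      rw [e] at h1
      have hx : (ht (P j) : ℝ) ≤ ht ![a, b, 0] := by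
        have : (0 : ℝ) ≤ ht (P j) := Nat.cast_nonneg _
        linarith
      have hp1 := (abs_le_ht (P j) 1).trans hx
      have hp2 := (abs_le_ht (P j) 2).trans hx
      set M : ℝ := (ht ![a, b, 0] : ℝ)
      set α := lf ζ ![a, b, 0]
      have hαM : |α| ≤ |α| * M ^ 2 := le_mul_of_one_le_right (abs_nonneg _) (one_le_pow₀ hM1)
      have hc1 : 1 / (4 * (2 + 2 * |ζ|)) ≤ 1 := by
        rw [div_le_one (by positivity)]; linarith [abs_nonneg ζ]
      have hα1 : |α| ≤ 1 := by linarith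
      have hMM : M ≤ M ^ 2 := by nlinarith
      have b1 : |b ^ 2 * lf ζ (P j)| ≤ 1 / 4 := by
        rw [abs_mul, abs_pow]
        calc |(b : ℝ)| ^ 2 * |lf ζ (P j)| ≤ (2 * ht (P (j + 1))) ^ 2 * |lf ζ (P j)| := by
              gcongr; exact hb.trans hspec'
          _ = 4 * (|lf ζ (P j)| * ht (P (j + 1)) ^ 2) := by ring
          _ ≤ 1 / 4 := by linarith
      have b2 : |P j 1 * b * α + 2 * P j 2 * b * ζ * α - P j 2 * α ^ 2|
          ≤ (2 + 2 * |ζ|) * (|α| * M ^ 2) := by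
        calc _ ≤ |(P j 1 : ℝ)| * |(b : ℝ)| * |α| + 2 * |(P j 2 : ℝ)| * |(b : ℝ)| * |ζ| * |α|
              + |(P j 2 : ℝ)| * |α| ^ 2 := by
              refine (abs_sub _ _).trans (add_le_add ((abs_add_le _ _).trans (le_of_eq ?_))
                (le_of_eq ?_)) <;> simp [abs_mul]
          _ ≤ M * M * |α| + 2 * M * M * |ζ| * |α| + M * (|α| * 1) := by
              rw [sq |α|]; gcongr
          _ ≤ M * M * |α| + 2 * M * M * |ζ| * |α| + M ^ 2 * (|α| * 1) := by gcongr
          _ = _ := by ring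
      have b3 : (2 + 2 * |ζ|) * (|α| * M ^ 2) < 1 / 4 := by
        calc _ < (2 + 2 * |ζ|) * (1 / (4 * (2 + 2 * |ζ|))) := by gcongr
          _ = 1 / 4 := by field_simp
      have := abs_sub (b ^ 2 * lf ζ (P j))
        (P j 1 * b * α + 2 * P j 2 * b * ζ * α - P j 2 * α ^ 2)
      linarith
    obtain ⟨c, d, e0, e1, e2⟩ := exists_factor (IsCoprime.neg_right hab.symm) hres
    have hprod := ht_mul_ht_le e0 e1 e2
    rw [neg_neg] at hprod
    have hdc : d ≠ 0 ∨ c ≠ 0 := by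
      by_contra! h
      apply hP.ne_zero j
      ext i
      fin_cases i <;> simp [e0, e1, e2, h.1, h.2]
    have hB : (1 : ℝ) ≤ ht ![d, c, 0] := by exact_mod_cast one_le_ht (vec_ne_zero hdc)
    nlinarith

lemma exists_eq_mul_coprime {a b : ℤ} (h : a ≠ 0 ∨ b ≠ 0) :
    ∃ g a' b' : ℤ, g ≠ 0 ∧ a = g * a' ∧ b = g * b' ∧ IsCoprime a' b' := by
  have hg : 0 < Int.gcd a b := Nat.pos_of_ne_zero fun h0 => by
    rw [Int.gcd_eq_zero_iff] at h0; tauto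
  obtain ⟨a', b', hc, ha, hb⟩ := Int.exists_gcd_one hg
  exact ⟨Int.gcd a b, a', b', by omega, by rw [mul_comm]; exact ha, by rw [mul_comm]; exact hb,
    Int.isCoprime_iff_gcd_eq_one.mpr hc⟩

lemma exists_linear_lower (hζ : Transcendental ℚ ζ) (hP : IsMinSeq ζ P)
    (hlim : ∀ ε > 0, ∃ k₀, ∀ k ≥ k₀, |lf ζ (P k)| * ht (P (k + 1)) ^ 2 ≤ ε) :
    ∃ c > 0, ∀ a b : ℤ, a ≠ 0 ∨ b ≠ 0 → c ≤ |lf ζ ![a, b, 0]| * ht ![a, b, 0] ^ 2 := by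
  obtain ⟨c, hc, hlow⟩ := exists_coprime_lower hζ hP hlim
  refine ⟨c, hc, fun a b hab => ?_⟩
  obtain ⟨g, a', b', hg, rfl, rfl, hco⟩ := exists_eq_mul_coprime hab
  refine (hlow a' b' hco).trans ?_
  have h1 : |lf ζ ![a', b', 0]| ≤ |lf ζ ![g * a', g * b', 0]| := by
    rw [show lf ζ ![g * a', g * b', 0] = g * lf ζ ![a', b', 0] by simp [lf]; ring, abs_mul]
    exact le_mul_of_one_le_left (abs_nonneg _) (one_le_abs_cast hg)
  have h2 : ht ![a', b', 0] ≤ ht ![g * a', g * b', 0] := by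
    refine Finset.sup_mono_fun fun i _ => ?_
    have : 1 ≤ g.natAbs := Int.natAbs_pos.mpr hg
    fin_cases i <;> simp [Int.natAbs_mul] <;> exact Nat.le_mul_of_pos_left _ this
  gcongr

lemma exists_noRoot (hζ : Transcendental ℚ ζ) (hP : IsMinSeq ζ P)
    (hlim : ∀ ε > 0, ∃ k₀, ∀ k ≥ k₀, |lf ζ (P k)| * ht (P (k + 1)) ^ 2 ≤ ε) :
    ∃ k₀, ∀ k ≥ k₀, NoRoot (P k) := by
  obtain ⟨c, hc, hlow⟩ := exists_linear_lower hζ hP hlim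
  obtain ⟨k₀, hk₀⟩ := hlim (c ^ 2 / 8) (by positivity)
  refine ⟨k₀, fun k hk s t hst h => ?_⟩
  obtain ⟨g, s', t', hg, rfl, rfl, hco⟩ := exists_eq_mul_coprime hst
  have h' : P k 0 * s' ^ 2 + P k 1 * s' * t' + P k 2 * t' ^ 2 = 0 := by
    apply mul_left_cancel₀ (pow_ne_zero 2 hg)
    linear_combination h
  obtain ⟨e, d, e0, e1, e2⟩ := exists_factor hco h'
  have hprod := ht_mul_ht_le e0 e1 e2
  have hst' : -t' ≠ 0 ∨ s' ≠ 0 := by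
    by_contra! h0
    apply hst.elim <;> intro h1 <;> apply h1 <;> simp [h0.2, neg_eq_zero.mp h0.1]
  have hde : d ≠ 0 ∨ e ≠ 0 := by
    by_contra! h
    apply hP.ne_zero k
    ext i
    fin_cases i <;> simp [e0, e1, e2, h.1, h.2]
  have hA := hlow _ _ hst'
  have hB := hlow _ _ hde
  have hlf : |lf ζ (P k)| = |lf ζ ![-t', s', 0]| * |lf ζ ![d, e, 0]| := by
    rw [← abs_mul]
    congr 1
    simp [lf, e0, e1, e2]; ring
  have hX : (ht (P k) : ℝ) ≤ ht (P (k + 1)) := by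
    exact_mod_cast (hP.ht_mono (Nat.lt_succ_self k)).le
  have := hk₀ k hk
  have : c ^ 2 ≤ c ^ 2 / 2 := by
    calc c ^ 2 = c * c := sq c
      _ ≤ (|lf ζ ![-t', s', 0]| * ht ![-t', s', 0] ^ 2)
          * (|lf ζ ![d, e, 0]| * ht ![d, e, 0] ^ 2) := by gcongr
      _ = |lf ζ (P k)| * (ht ![-t', s', 0] * ht ![d, e, 0]) ^ 2 := by rw [hlf]; ring
      _ ≤ |lf ζ (P k)| * (2 * ht (P (k + 1))) ^ 2 :=
        mul_le_mul_of_nonneg_left (pow_le_pow_left₀ (by positivity) (by linarith) 2)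
          (abs_nonneg _)
      _ = 4 * (|lf ζ (P k)| * ht (P (k + 1)) ^ 2) := by ring
      _ ≤ c ^ 2 / 2 := by linarith
  nlinarith

/-! ### Planes spanned by consecutive minimal points -/

lemma IsMinSeq.not_prop2 (hP : IsMinSeq ζ P) {j k : ℕ} (hjk : j < k) : ¬ Prop2 (P j) (P k) := by
  rintro ⟨h0, h1, h2⟩
  have hX : (ht (P j) : ℝ) < ht (P k) := by exact_mod_cast hP.ht_mono hjk
  have hL : |lf ζ (P k)| < |lf ζ (P j)| := hP.lf_anti hjk
  obtain ⟨i, hi⟩ := exists_abs_eq_ht (P k)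
  have hj := abs_le_ht (P j) i
  have h0' : (P j 1 * P k 2 - P j 2 * P k 1 : ℝ) = 0 := by exact_mod_cast h0
  have h1' : (P j 2 * P k 0 - P j 0 * P k 2 : ℝ) = 0 := by exact_mod_cast h1
  have h2' : (P j 0 * P k 1 - P j 1 * P k 0 : ℝ) = 0 := by exact_mod_cast h2
  have e : P j i * lf ζ (P k) = P k i * lf ζ (P j) := by
    simp only [lf]
    fin_cases i <;> simp only [Fin.zero_eta, Fin.mk_one, Fin.reduceFinMk]
    · linear_combination ζ * h2' - ζ ^ 2 * h1'
    · linear_combination -h2' + ζ ^ 2 * h0'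
    · linear_combination h1' - ζ * h0'
  have e' := congrArg abs e
  rw [abs_mul, abs_mul, hi] at e'
  have := abs_nonneg (lf ζ (P k))
  nlinarith [mul_le_mul hj hL.le this (by positivity),
    mul_lt_mul_of_pos_right hX (this.trans_lt hL)]

lemma det3_eq_zero_of_plane {A B C D E : Fin 3 → ℤ} (hC : det3 A B C = 0) (hD : det3 A B D = 0)
    (hE : det3 C D E = 0) (hCD : ¬ Prop2 C D) : det3 A B E = 0 := by
  by_contra h
  apply hCD
  simp only [det3] at *
  refine ⟨mul_left_cancel₀ h ?_, mul_left_cancel₀ h ?_, mul_left_cancel₀ h ?_⟩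
  · linear_combination (A 1 * B 2 - A 2 * B 1) * hE
      + (E 1 * D 2 - E 2 * D 1) * hC + (E 2 * C 1 - E 1 * C 2) * hD
  · linear_combination (A 2 * B 0 - A 0 * B 2) * hE
      + (E 2 * D 0 - E 0 * D 2) * hC + (E 0 * C 2 - E 2 * C 0) * hD
  · linear_combination (A 0 * B 1 - A 1 * B 0) * hE
      + (E 0 * D 1 - E 1 * D 0) * hC + (E 1 * C 0 - E 0 * C 1) * hD

lemma IsMinSeq.det3_eq_zero (hP : IsMinSeq ζ P) {a b : ℕ}
    (hab : ∀ j, a ≤ j → j < b → det3 (P j) (P (j + 1)) (P (j + 2)) = 0) (j : ℕ)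
    (haj : a ≤ j) (hjb : j ≤ b + 1) : det3 (P a) (P (a + 1)) (P j) = 0 := by
  induction j using Nat.strong_induction_on with
  | _ j ih =>
    obtain ⟨i, rfl⟩ := Nat.exists_eq_add_of_le haj
    match i with
    | 0 => simp only [det3, add_zero]; ring
    | 1 => simp only [det3]; ring
    | i + 2 =>
      exact det3_eq_zero_of_plane (ih (a + i) (by omega) (by omega) (by omega))
        (ih (a + i + 1) (by omega) (by omega) (by omega))
        (hab (a + i) (by omega) (by omega)) (hP.not_prop2 (Nat.lt_succ_self _))

/-- Infinitely many triples of consecutive minimal points are linearly independent. -/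
lemma IsMinSeq.exists_det3_ne_zero (hζ : Transcendental ℚ ζ) (hP : IsMinSeq ζ P)
    (hlim : ∀ ε > 0, ∃ k₀, ∀ k ≥ k₀, |lf ζ (P k)| * ht (P (k + 1)) ^ 2 ≤ ε) (K : ℕ) :
    ∃ k ≥ K, det3 (P k) (P (k + 1)) (P (k + 2)) ≠ 0 := by
  by_contra! h
  have hpl (j : ℕ) (hj : K ≤ j) : det3 (P K) (P (K + 1)) (P j) = 0 :=
    hP.det3_eq_zero (b := j) (fun i hi _ => h i hi) j hj (by omega)
  set A := P K
  set B := P (K + 1)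
  set N : ℝ := max |(A 1 * B 2 - A 2 * B 1 : ℝ)|
    (max |(A 2 * B 0 - A 0 * B 2 : ℝ)| |(A 0 * B 1 - A 1 * B 0 : ℝ)|) with hN
  have hN0 : |(A 1 * B 2 - A 2 * B 1 : ℝ)| ≤ N := le_max_left _ _
  have hN1 : |(A 2 * B 0 - A 0 * B 2 : ℝ)| ≤ N := (le_max_left _ _).trans (le_max_right _ _)
  have hN2 : |(A 0 * B 1 - A 1 * B 0 : ℝ)| ≤ N := (le_max_right _ _).trans (le_max_right _ _)
  have hNn : 0 ≤ N := (abs_nonneg _).trans hN0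
  have key (x : ℝ) (hx : ∀ l ≥ K, ∃ m : ℤ, ∃ n e : ℝ, m ≠ 0 ∧ |n| ≤ N ∧
      |e| ≤ 2 * |lf ζ (P l)| * ht (P (l + 1)) ∧ m * x = n * e) : x = 0 := by
    by_contra hx0
    have hpos : 0 < |x| := abs_pos.mpr hx0
    obtain ⟨k₀, hk₀⟩ := hlim (|x| / (4 * (N + 1))) (by positivity)
    obtain ⟨m, n, e, hm, hn, he, hmx⟩ := hx (max k₀ K) (le_max_right _ _)
    have hl := hk₀ (max k₀ K) (le_max_left _ _)
    set l := max k₀ K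
    have h1 : (1 : ℝ) ≤ ht (P (l + 1)) := by exact_mod_cast one_le_ht (hP.ne_zero _)
    have : |x| ≤ |x| / 2 := by
      calc |x| ≤ |(m : ℝ)| * |x| := le_mul_of_one_le_left hpos.le (one_le_abs_cast hm)
        _ = |n| * |e| := by rw [← abs_mul, hmx, abs_mul]
        _ ≤ (N + 1) * (2 * |lf ζ (P l)| * ht (P (l + 1))) := by gcongr; linarith
        _ ≤ (N + 1) * (2 * |lf ζ (P l)| * ht (P (l + 1)) ^ 2) := by
          gcongr; exact le_self_pow₀ h1 two_ne_zero
        _ = 2 * (N + 1) * (|lf ζ (P l)| * ht (P (l + 1)) ^ 2) := by ring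
        _ ≤ 2 * (N + 1) * (|x| / (4 * (N + 1))) := by gcongr
        _ = |x| / 2 := by field_simp; norm_num
    linarith
  have hcross (l : ℕ) (hl : K ≤ l) : ∃ m₀ m₁ m₂ : ℤ, (m₀ ≠ 0 ∨ m₁ ≠ 0 ∨ m₂ ≠ 0) ∧
      m₀ = P l 1 * P (l + 1) 2 - P l 2 * P (l + 1) 1 ∧
      m₁ = P l 2 * P (l + 1) 0 - P l 0 * P (l + 1) 2 ∧
      m₂ = P l 0 * P (l + 1) 1 - P l 1 * P (l + 1) 0 := by
    refine ⟨_, _, _, ?_, rfl, rfl, rfl⟩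
    have := hP.not_prop2 (Nat.lt_succ_self l)
    unfold Prop2 at this
    tauto
  have hx₁ : (A 2 * B 0 - A 0 * B 2 - ζ * (A 1 * B 2 - A 2 * B 1) : ℝ) = 0 := by
    refine key _ fun l hl => ?_
    obtain ⟨m₀, m₁, m₂, hm, hm₀, hm₁, hm₂⟩ := hcross l hl
    have d1 : (det3 A B (P l) : ℝ) = 0 := by exact_mod_cast hpl l hl
    have d2 : (det3 A B (P (l + 1)) : ℝ) = 0 := by exact_mod_cast hpl (l + 1) (by omega)
    have hX : (ht (P l) : ℝ) ≤ ht (P (l + 1)) := by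
      exact_mod_cast (hP.ht_mono (Nat.lt_succ_self l)).le
    have hL : |lf ζ (P (l + 1))| ≤ |lf ζ (P l)| := (hP.lf_anti (Nat.lt_succ_self l)).le
    have he : |lf ζ (P (l + 1)) * P l 2 - lf ζ (P l) * P (l + 1) 2|
        ≤ 2 * |lf ζ (P l)| * ht (P (l + 1)) :=
      abs_minor_le hL ((abs_le_ht _ 2).trans hX) le_rfl (abs_le_ht _ 2)
    simp only [det3] at d1 d2
    push_cast at d1 d2
    rcases hm with hm | hm | hm
    · refine ⟨m₀, _, _, hm, hN0, he, ?_⟩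
      rw [hm₀]; simp only [lf]; push_cast
      linear_combination P (l + 1) 2 * d1 - P l 2 * d2
    · refine ⟨m₁, _, _, hm, hN1, he, ?_⟩
      rw [hm₁]; simp only [lf]; push_cast
      linear_combination ζ * (P (l + 1) 2 * d1 - P l 2 * d2)
    · refine ⟨m₂, _, _, hm, hN2, he, ?_⟩
      rw [hm₂]; simp only [lf]; push_cast
      linear_combination -(P (l + 1) 0 + ζ * P (l + 1) 1) * d1 + (P l 0 + ζ * P l 1) * d2
  have hx₂ : (A 0 * B 1 - A 1 * B 0 - ζ ^ 2 * (A 1 * B 2 - A 2 * B 1) : ℝ) = 0 := by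
    refine key _ fun l hl => ?_
    obtain ⟨m₀, m₁, m₂, hm, hm₀, hm₁, hm₂⟩ := hcross l hl
    have d1 : (det3 A B (P l) : ℝ) = 0 := by exact_mod_cast hpl l hl
    have d2 : (det3 A B (P (l + 1)) : ℝ) = 0 := by exact_mod_cast hpl (l + 1) (by omega)
    have hX : (ht (P l) : ℝ) ≤ ht (P (l + 1)) := by
      exact_mod_cast (hP.ht_mono (Nat.lt_succ_self l)).le
    have hL : |lf ζ (P (l + 1))| ≤ |lf ζ (P l)| := (hP.lf_anti (Nat.lt_succ_self l)).le
    have he : |lf ζ (P l) * P (l + 1) 1 - lf ζ (P (l + 1)) * P l 1|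
        ≤ 2 * |lf ζ (P l)| * ht (P (l + 1)) :=
      abs_minor_le le_rfl (abs_le_ht _ 1) hL ((abs_le_ht _ 1).trans hX)
    simp only [det3] at d1 d2
    push_cast at d1 d2
    rcases hm with hm | hm | hm
    · refine ⟨m₀, _, _, hm, hN0, he, ?_⟩
      rw [hm₀]; simp only [lf]; push_cast
      linear_combination -P (l + 1) 1 * d1 + P l 1 * d2
    · refine ⟨m₁, _, _, hm, hN1, he, ?_⟩
      rw [hm₁]; simp only [lf]; push_cast
      linear_combination (P (l + 1) 0 + ζ ^ 2 * P (l + 1) 2) * d1 - (P l 0 + ζ ^ 2 * P l 2) * d2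
    · refine ⟨m₂, _, _, hm, hN2, he, ?_⟩
      rw [hm₂]; simp only [lf]; push_cast
      linear_combination -ζ ^ 2 * P (l + 1) 1 * d1 + ζ ^ 2 * P l 1 * d2
  have hz₁ : ![A 2 * B 0 - A 0 * B 2, -(A 1 * B 2 - A 2 * B 1), 0] = 0 := by
    by_contra hne
    refine lf_ne_zero hζ hne ?_
    simp only [lf, Matrix.cons_val_zero, Matrix.cons_val_one, Matrix.cons_val]
    push_cast
    linear_combination hx₁
  have hz₂ : ![A 0 * B 1 - A 1 * B 0, 0, -(A 1 * B 2 - A 2 * B 1)] = 0 := by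
    by_contra hne
    refine lf_ne_zero hζ hne ?_
    simp only [lf, Matrix.cons_val_zero, Matrix.cons_val_one, Matrix.cons_val]
    push_cast
    linear_combination hx₂
  refine hP.not_prop2 (Nat.lt_succ_self K) ⟨?_, congrFun hz₁ 0, congrFun hz₂ 0⟩
  exact neg_eq_zero.mp (congrFun hz₁ 1)

/-- Two consecutive minimal points form a basis of the integer points in their plane. -/
lemma IsMinSeq.exists_int_combination (hP : IsMinSeq ζ P) {k : ℕ} {R : Fin 3 → ℤ}
    (hR : det3 (P k) (P (k + 1)) R = 0) :
    ∃ q q' : ℤ, ∀ i, R i = q * P k i + q' * P (k + 1) i := by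
  have hn := hP.not_prop2 (Nat.lt_succ_self k)
  obtain ⟨N, α, β, hN, hcomb⟩ : ∃ N α β : ℤ, N ≠ 0 ∧
      ∀ i, N * R i = α * P k i + β * P (k + 1) i := by
    simp only [det3] at hR
    simp only [Prop2, not_and_or] at hn
    rcases hn with hn | hn | hn
    · refine ⟨_, R 1 * P (k + 1) 2 - R 2 * P (k + 1) 1, P k 1 * R 2 - P k 2 * R 1, hn, ?_⟩
      intro i
      fin_cases i <;> simp only [Fin.zero_eta, Fin.mk_one, Fin.reduceFinMk, Nat.succ_eq_add_one]
      · linear_combination hR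
      · ring
      · ring
    · refine ⟨_, R 2 * P (k + 1) 0 - R 0 * P (k + 1) 2, P k 2 * R 0 - P k 0 * R 2, hn, ?_⟩
      intro i
      fin_cases i <;> simp only [Fin.zero_eta, Fin.mk_one, Fin.reduceFinMk, Nat.succ_eq_add_one]
      · ring
      · linear_combination hR
      · ring
    · refine ⟨_, R 0 * P (k + 1) 1 - R 1 * P (k + 1) 0, P k 0 * R 1 - P k 1 * R 0, hn, ?_⟩
      intro i
      fin_cases i <;> simp only [Fin.zero_eta, Fin.mk_one, Fin.reduceFinMk, Nat.succ_eq_add_one]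
      · ring
      · ring
      · linear_combination hR
  have hNR : (N : ℝ) ≠ 0 := by exact_mod_cast hN
  set q := round ((α : ℝ) / N)
  set q' := round ((β : ℝ) / N)
  refine ⟨q, q', ?_⟩
  by_contra! hne
  have hr : |(α : ℝ) / N - q| ≤ 1 / 2 := abs_sub_round _
  have hr' : |(β : ℝ) / N - q'| ≤ 1 / 2 := abs_sub_round _
  set r := (α : ℝ) / N - q with hr_def
  set r' := (β : ℝ) / N - q' with hr'_def
  set S : Fin 3 → ℤ := fun i => R i - (q * P k i + q' * P (k + 1) i) with hS
  have hSi (i : Fin 3) : (S i : ℝ) = r * P k i + r' * P (k + 1) i := by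
    have h : (N : ℝ) * R i = α * P k i + β * P (k + 1) i := by exact_mod_cast hcomb i
    simp only [hS, hr_def, hr'_def]
    push_cast
    field_simp
    linear_combination h
  have hS0 : S ≠ 0 := by
    obtain ⟨i, hi⟩ := hne
    exact fun h => hi (sub_eq_zero.mp (congrFun h i))
  have hX : (ht (P k) : ℝ) < ht (P (k + 1)) := by
    exact_mod_cast hP.ht_mono (Nat.lt_succ_self k)
  have hL : |lf ζ (P (k + 1))| < |lf ζ (P k)| := hP.lf_anti (Nat.lt_succ_self k)
  have hcomb_le {x y : ℝ} : |r * x + r' * y| ≤ (|x| + |y|) / 2 := by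
    calc |r * x + r' * y| ≤ |r| * |x| + |r'| * |y| := by
          rw [← abs_mul, ← abs_mul]; exact abs_add_le _ _
      _ ≤ 1 / 2 * |x| + 1 / 2 * |y| := by gcongr
      _ = _ := by ring
  have hSht : ht S < ht (P (k + 1)) := by
    obtain ⟨i, hi⟩ := exists_abs_eq_ht S
    have : (ht S : ℝ) < ht (P (k + 1)) := by
      rw [← hi, hSi]
      refine hcomb_le.trans_lt ?_
      linarith [abs_le_ht (P k) i, abs_le_ht (P (k + 1)) i]
    exact_mod_cast this
  have hSlf : lf ζ S = r * lf ζ (P k) + r' * lf ζ (P (k + 1)) := by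
    simp only [lf, hSi]; ring
  have := hP.le_lf k S hS0 hSht
  rw [hSlf] at this
  linarith [this.trans hcomb_le]

lemma IsMinSeq.lf_mul_ht_le (hP : IsMinSeq ζ P) {k l : ℕ}
    (h₁ : det3 (P k) (P (k + 1)) (P l) = 0) (h₂ : det3 (P k) (P (k + 1)) (P (l + 1)) = 0)
    (hgap : 2 * ht (P k) ≤ ht (P (k + 1))) :
    |lf ζ (P k)| * ht (P (k + 1)) ≤ 4 * (|lf ζ (P l)| * ht (P (l + 1))) := by
  obtain ⟨a, b, hab⟩ := hP.exists_int_combination h₁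
  obtain ⟨c, d, hcd⟩ := hP.exists_int_combination h₂
  have hN : a * d - b * c ≠ 0 := by
    intro h0
    apply hP.not_prop2 (Nat.lt_succ_self l)
    simp only [Prop2, Nat.succ_eq_add_one, hab, hcd]
    refine ⟨?_, ?_, ?_⟩
    · linear_combination (P k 1 * P (k + 1) 2 - P k 2 * P (k + 1) 1) * h0
    · linear_combination (P k 2 * P (k + 1) 0 - P k 0 * P (k + 1) 2) * h0
    · linear_combination (P k 0 * P (k + 1) 1 - P k 1 * P (k + 1) 0) * h0
  obtain ⟨i, hi⟩ := exists_abs_eq_ht (P (k + 1))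
  have e : lf ζ (P l) * P (l + 1) i - lf ζ (P (l + 1)) * P l i
      = (a * d - b * c : ℤ) * (lf ζ (P k) * P (k + 1) i - lf ζ (P (k + 1)) * P k i) := by
    simp only [lf, hab, hcd]; push_cast; ring
  have hX : (ht (P l) : ℝ) ≤ ht (P (l + 1)) := by
    exact_mod_cast (hP.ht_mono (Nat.lt_succ_self l)).le
  have hL : |lf ζ (P (l + 1))| ≤ |lf ζ (P l)| := (hP.lf_anti (Nat.lt_succ_self l)).le
  have hLk : |lf ζ (P (k + 1))| ≤ |lf ζ (P k)| := (hP.lf_anti (Nat.lt_succ_self k)).le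
  have hub := abs_minor_le (le_refl |lf ζ (P l)|) (abs_le_ht (P (l + 1)) i) hL
    ((abs_le_ht (P l) i).trans hX)
  rw [e, abs_mul] at hub
  have hgap' : 2 * (ht (P k) : ℝ) ≤ ht (P (k + 1)) := by exact_mod_cast hgap
  have hlb : |lf ζ (P k)| * ht (P (k + 1)) / 2
      ≤ |lf ζ (P k) * P (k + 1) i - lf ζ (P (k + 1)) * P k i| := by
    refine le_trans ?_ (abs_sub_abs_le_abs_sub _ _)
    rw [abs_mul, abs_mul, hi]
    have : |lf ζ (P (k + 1))| * |(P k i : ℝ)| ≤ |lf ζ (P k)| * (ht (P (k + 1)) / 2) := by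
      gcongr
      linarith [abs_le_ht (P k) i]
    linarith
  have := le_mul_of_one_le_left (abs_nonneg (lf ζ (P k) * P (k + 1) i - lf ζ (P (k + 1)) * P k i))
    (one_le_abs_cast hN)
  linarith

end

/-! ### Passing between coefficient vectors and polynomials -/

/-- The polynomial `v₀ + v₁ T + v₂ T²`. -/
noncomputable def toPoly (v : Fin 3 → ℤ) : ℤ[X] := C (v 0) + C (v 1) * X + C (v 2) * X ^ 2

lemma aeval_toPoly {R : Type*} [CommRing R] (θ : R) (v : Fin 3 → ℤ) :
    aeval θ (toPoly v) = lf θ v := by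
  simp [toPoly, lf]

lemma natDegree_toPoly_le (v : Fin 3 → ℤ) : (toPoly v).natDegree ≤ 2 := by
  unfold toPoly; compute_degree

lemma abs_coeff_toPoly_le (v : Fin 3 → ℤ) (n : ℕ) : |((toPoly v).coeff n : ℝ)| ≤ ht v := by
  match n with
  | 0 => simpa [toPoly, coeff_X, coeff_C, -eq_intCast] using abs_le_ht v 0
  | 1 => simpa [toPoly, coeff_X, coeff_C, -eq_intCast] using abs_le_ht v 1
  | 2 => simpa [toPoly, coeff_X, coeff_C, -eq_intCast] using abs_le_ht v 2
  | n + 3 =>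
    rw [coeff_eq_zero_of_natDegree_lt (by have := natDegree_toPoly_le v; omega)]
    simp

lemma toPoly_eq_zero {v : Fin 3 → ℤ} (h : toPoly v = 0) : v = 0 := by
  ext i
  have hc := congrArg (fun p => Polynomial.coeff p (i : ℕ)) h
  fin_cases i <;> simpa [toPoly, coeff_X, coeff_C, -eq_intCast] using hc

lemma polyH_le {p : ℤ[X]} {c : ℝ} (hc : 0 ≤ c) (h : ∀ n, |(p.coeff n : ℝ)| ≤ c) :
    polyH p ≤ c := by
  have hle : (p.support.sup fun i => (p.coeff i).natAbs) ≤ ⌊c⌋₊ := by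
    refine Finset.sup_le fun n _ => Nat.le_floor ?_
    rw [Nat.cast_natAbs, Int.cast_abs]
    exact h n
  exact (Nat.cast_le.mpr hle).trans (Nat.floor_le hc)

lemma abs_coeff_X_pow_mul_toPoly_le (v : Fin 3 → ℤ) (j n : ℕ) :
    |((X ^ j * toPoly v).coeff n : ℝ)| ≤ ht v := by
  rw [coeff_X_pow_mul']
  split_ifs
  · exact abs_coeff_toPoly_le v _
  · simp

lemma abs_coeff_mul_toPoly_le (v w : Fin 3 → ℤ) (n : ℕ) :
    |((toPoly v * toPoly w).coeff n : ℝ)| ≤ 3 * (ht v * ht w) := by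
  have e : toPoly v * toPoly w = C (v 0) * (X ^ 0 * toPoly w) + C (v 1) * (X ^ 1 * toPoly w)
      + C (v 2) * (X ^ 2 * toPoly w) := by
    rw [toPoly]; ring
  have hterm (i : Fin 3) (j : ℕ) : |(v i * (X ^ j * toPoly w).coeff n : ℝ)| ≤ ht v * ht w := by
    rw [abs_mul]
    exact mul_le_mul (abs_le_ht v i) (abs_coeff_X_pow_mul_toPoly_le w j n) (abs_nonneg _)
      (Nat.cast_nonneg _)
  rw [e, coeff_add, coeff_add, coeff_C_mul, coeff_C_mul, coeff_C_mul]
  push_cast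
  refine (abs_add_three _ _ _).trans ?_
  linarith [hterm 0 0, hterm 1 1, hterm 2 2]

lemma exists_vec {ζ : ℝ} {p : ℤ[X]} (hp : p.natDegree ≤ 2) (h0 : 0 < |pev ζ p|) :
    ∃ v : Fin 3 → ℤ, v ≠ 0 ∧ (ht v : ℝ) ≤ polyH p ∧ lf ζ v = pev ζ p := by
  have hlf : lf ζ (fun i : Fin 3 => p.coeff i) = pev ζ p := by
    rw [pev, aeval_eq_sum_range' (n := 3) (by omega)]
    simp [Finset.sum_range_succ, lf]
  refine ⟨fun i => p.coeff i, fun h => ?_, ?_, hlf⟩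
  · rw [h] at hlf
    rw [← hlf] at h0
    simp [lf] at h0
  · refine Nat.cast_le.mpr (Finset.sup_le fun i _ => ?_)
    by_cases hi : (i : ℕ) ∈ p.support
    · exact Finset.le_sup (f := fun i => (p.coeff i).natAbs) hi
    · simp [notMem_support_iff.mp hi]

lemma prop2_of_res_eq_zero {A B : Fin 3 → ℤ} (hA : NoRoot A) (h : res A B = 0) : Prop2 A B := by
  set n₀ := A 1 * B 2 - A 2 * B 1 with hn₀
  set n₁ := A 2 * B 0 - A 0 * B 2 with hn₁
  set n₂ := A 0 * B 1 - A 1 * B 0 with hn₂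
  have hAn : A 0 * n₀ + A 1 * n₁ + A 2 * n₂ = 0 := by rw [hn₀, hn₁, hn₂]; ring
  have h' : n₁ ^ 2 - n₀ * n₂ = 0 := h
  have h₀ : n₀ = 0 := by
    by_contra hne
    exact hA n₀ n₁ (Or.inl hne) (by linear_combination n₀ * hAn + A 2 * h')
  have h₁ : n₁ = 0 := by
    rw [h₀] at h'
    exact pow_eq_zero_iff two_ne_zero |>.mp (by linear_combination h')
  refine ⟨h₀, h₁, ?_⟩
  by_contra hne
  rw [h₀, h₁] at hAn
  have hA2 : A 2 = 0 := by
    rcases mul_eq_zero.mp (by linear_combination hAn : A 2 * n₂ = 0) with h | h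
    · exact h
    · exact absurd h hne
  exact hA 0 1 (Or.inr one_ne_zero) (by linear_combination hA2)

lemma res_eq_zero_of_common_root {A B : Fin 3 → ℤ} {θ : ℂ} (hA : lf θ A = 0) (hB : lf θ B = 0) :
    res A B = 0 := by
  have : ((res A B : ℤ) : ℂ) = 0 := by
    simp only [lf] at hA hB
    simp only [res]
    push_cast
    have e₁ : (A 2 * B 0 - A 0 * B 2 : ℂ) = θ * (A 1 * B 2 - A 2 * B 1) := by
      linear_combination A 2 * hB - B 2 * hA
    have e₂ : (A 0 * B 1 - A 1 * B 0 : ℂ) = θ ^ 2 * (A 1 * B 2 - A 2 * B 1) := by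
      linear_combination B 1 * hA - A 1 * hB
    rw [e₁, e₂]; ring
  exact_mod_cast this

lemma NoRoot.exists_lf_eq_zero {A : Fin 3 → ℤ} (hA : NoRoot A) : ∃ θ : ℂ, lf θ A = 0 := by
  have hA2 : (A 2 : ℂ) ≠ 0 := by
    intro h
    have h' : A 2 = 0 := by exact_mod_cast h
    exact hA 0 1 (Or.inr one_ne_zero) (by linear_combination h')
  obtain ⟨δ, hδ⟩ := IsAlgClosed.exists_pow_nat_eq ((A 1 : ℂ) ^ 2 - 4 * A 2 * A 0) two_pos
  refine ⟨(-A 1 + δ) / (2 * A 2), ?_⟩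
  rw [lf]
  field_simp
  linear_combination hδ

lemma NoRoot.ne_zero {A : Fin 3 → ℤ} (hA : NoRoot A) : A ≠ 0 := fun h =>
  hA 0 1 (Or.inr one_ne_zero) (by simp [h])

lemma linearIndependent_of_noRoot {A B D : Fin 3 → ℤ} (hA : NoRoot A) (hAB : ¬ Prop2 A B)
    (hAD : ¬ Prop2 A D) : LinearIndependent ℤ
      ![X ^ 0 * toPoly A, X ^ 1 * toPoly A, X ^ 2 * toPoly A, toPoly B * toPoly D] := by
  rw [Fintype.linearIndependent_iff]
  intro g hg
  rw [Fin.sum_univ_four] at hg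
  simp only [Matrix.cons_val_zero, Matrix.cons_val_one, Matrix.cons_val] at hg
  obtain ⟨θ, hθ⟩ := hA.exists_lf_eq_zero
  have hB : lf θ B ≠ 0 := fun h =>
    hAB (prop2_of_res_eq_zero hA (res_eq_zero_of_common_root hθ h))
  have hD : lf θ D ≠ 0 := fun h =>
    hAD (prop2_of_res_eq_zero hA (res_eq_zero_of_common_root hθ h))
  have h3 : g 3 = 0 := by
    have h := congrArg (aeval θ) hg
    simp only [map_add, map_mul, aeval_toPoly, hθ, mul_zero, zero_add, map_intCast,
      map_zero, zsmul_eq_mul, mul_eq_zero, hB, hD, or_self, or_false] at h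
    exact_mod_cast h
  have hmul : toPoly ![g 0, g 1, g 2] * toPoly A = 0 := by
    rw [← hg, h3]
    conv_lhs => rw [toPoly]
    simp only [smul_eq_C_mul, Matrix.cons_val_zero, Matrix.cons_val_one, Matrix.cons_val, C_0]
    ring
  have hg0 : ![g 0, g 1, g 2] = 0 := by
    rcases mul_eq_zero.mp hmul with h | h
    · exact toPoly_eq_zero h
    · exact absurd (toPoly_eq_zero h) hA.ne_zero
  intro i
  fin_cases i
  · exact congrFun hg0 0
  · exact congrFun hg0 1
  · exact congrFun hg0 2
  · exact h3

/-! ### Consequences of the value of the uniform exponent -/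

lemma exists_mem_whSet {ζ w : ℝ} (hζ : IsExtremal ζ) (hw : w < (3 + √5) / 2) :
    ∃ η ∈ whSet 2 ζ, w < η := by
  refine exists_lt_of_lt_csSup ?_ (by rw [← hζ.2] at hw; exact hw)
  by_contra hne
  have h := hζ.2
  rw [whExp, Set.not_nonempty_iff_eq_empty.mp hne, Real.sSup_empty] at h
  have := Real.sqrt_nonneg 5
  linarith

lemma exists_vec_of_mem_whSet {ζ η : ℝ} (h : η ∈ whSet 2 ζ) : ∃ X₀ : ℝ, ∀ Y ≥ X₀,
    ∃ v : Fin 3 → ℤ, v ≠ 0 ∧ (ht v : ℝ) ≤ Y ∧ |lf ζ v| ≤ Y ^ (-η) := by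
  obtain ⟨X₀, hX₀⟩ := h
  refine ⟨X₀, fun Y hY => ?_⟩
  obtain ⟨p, hp, hpH, hp0, hpη⟩ := hX₀ Y hY
  obtain ⟨v, hv, hvH, hvζ⟩ := exists_vec hp hp0
  exact ⟨v, hv, hvH.trans hpH, hvζ ▸ hpη⟩

lemma exists_isMinSeq_of_isExtremal {ζ : ℝ} (hζ : IsExtremal ζ) : ∃ P, IsMinSeq ζ P := by
  refine exists_isMinSeq hζ.1 fun δ hδ => ?_
  obtain ⟨η, hη, hη0⟩ := exists_mem_whSet hζ (w := 0) (by positivity)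
  obtain ⟨X₀, hX₀⟩ := exists_vec_of_mem_whSet hη
  obtain ⟨Y, hY, hYδ⟩ := ((Filter.eventually_ge_atTop X₀).and
    ((tendsto_rpow_neg_atTop hη0).eventually (gt_mem_nhds hδ))).exists
  obtain ⟨v, hv, -, hvY⟩ := hX₀ Y hY
  exact ⟨v, hv, hvY.trans_lt hYδ⟩

lemma IsMinSeq.tendsto_log_ht {ζ : ℝ} {P : ℕ → Fin 3 → ℤ} (hP : IsMinSeq ζ P) :
    Filter.Tendsto (fun k => Real.log (ht (P k))) Filter.atTop Filter.atTop :=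
  Real.tendsto_log_atTop.comp (tendsto_natCast_atTop_atTop.comp hP.ht_mono.tendsto_atTop)

lemma IsMinSeq.eventually_le_neg_log {ζ : ℝ} {P : ℕ → Fin 3 → ℤ} (hζ : IsExtremal ζ)
    (hP : IsMinSeq ζ P) {w : ℝ} (hw : w < (3 + √5) / 2) :
    ∀ᶠ k in Filter.atTop, w * Real.log (ht (P (k + 1))) ≤ -Real.log |lf ζ (P k)| := by
  obtain ⟨η, hη, hwη⟩ := exists_mem_whSet hζ hw
  obtain ⟨X₀, hX₀⟩ := exists_vec_of_mem_whSet hη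
  have hx := hP.tendsto_log_ht.comp (Filter.tendsto_add_atTop_nat 1)
  have hX : Filter.Tendsto (fun k => (ht (P (k + 1)) : ℝ)) Filter.atTop Filter.atTop :=
    tendsto_natCast_atTop_atTop.comp
      (hP.ht_mono.tendsto_atTop.comp (Filter.tendsto_add_atTop_nat 1))
  filter_upwards [hx.eventually_ge_atTop (η * Real.log 2 / (η - w)),
    hX.eventually_ge_atTop (2 * X₀)] with k hk hk'
  have hpos : (0 : ℝ) < ht (P (k + 1)) := by exact_mod_cast one_le_ht (hP.ne_zero _)
  obtain ⟨v, hv, hvH, hvη⟩ := hX₀ (ht (P (k + 1)) / 2) (by linarith)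
  have hlt : (ht v : ℝ) < ht (P (k + 1)) := by linarith
  have hL := (hP.le_lf k v hv (by exact_mod_cast hlt)).trans hvη
  have hlog := Real.log_le_log (abs_pos.mpr (lf_ne_zero hζ.1 (hP.ne_zero k))) hL
  rw [Real.log_rpow (by positivity), Real.log_div hpos.ne' two_ne_zero] at hlog
  simp only [Function.comp_apply] at hk
  rw [div_le_iff₀ (by linarith)] at hk
  nlinarith

lemma IsMinSeq.exists_lf_mul_ht_sq_le {ζ : ℝ} {P : ℕ → Fin 3 → ℤ} (hζ : IsExtremal ζ)
    (hP : IsMinSeq ζ P) :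
    ∀ ε > 0, ∃ k₀, ∀ k ≥ k₀, |lf ζ (P k)| * ht (P (k + 1)) ^ 2 ≤ ε := by
  intro ε hε
  have h5 : (2.2 : ℝ) < √5 := Real.lt_sqrt_of_sq_lt (by norm_num)
  have h₁ := hP.eventually_le_neg_log hζ (w := 5 / 2) (by linarith)
  have hx := (hP.tendsto_log_ht.comp (Filter.tendsto_add_atTop_nat 1)).eventually_ge_atTop
    (-2 * Real.log ε)
  obtain ⟨k₀, hk₀⟩ := Filter.eventually_atTop.mp (h₁.and hx)
  refine ⟨k₀, fun k hk => ?_⟩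
  obtain ⟨h₁, h₂⟩ := hk₀ k hk
  simp only [Function.comp_apply] at h₂
  have hpos : (0 : ℝ) < ht (P (k + 1)) := by exact_mod_cast one_le_ht (hP.ne_zero _)
  have hL := abs_pos.mpr (lf_ne_zero hζ.1 (hP.ne_zero k))
  rw [← Real.log_le_log_iff (by positivity) hε, Real.log_mul hL.ne' (by positivity), Real.log_pow]
  push_cast
  linarith

/-! ### Logarithmic inequalities -/

/-- Inequalities for the logarithmic heights `y`, `u` and values `l`, `m` of the points following
the first one of a linearly independent triple, up to an error `C`. -/
structure LogBounds (w C l y m u : ℝ) : Prop where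
  err : 0 ≤ C
  le_l : w * y ≤ l
  le_m : w * u ≤ m
  l_le : l ≤ y + u + C
  m_le : m ≤ 2 * u + y + C

section

variable {φ ε C l y m u l' y' m' u' : ℝ}

lemma LogBounds.le_u (h : LogBounds (φ ^ 2 - ε) C l y m u) (hφ : φ ^ 2 = φ + 1)
    (hC : C ≤ ε * y) : (φ - 2 * ε) * y ≤ u := by
  have h₁ := h.le_l
  rw [hφ] at h₁
  linarith [h.l_le]

lemma LogBounds.le_y (h : LogBounds (φ ^ 2 - ε) C l y m u) (hφ : φ ^ 2 = φ + 1)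
    (hC : C ≤ ε * u) : (φ - 1 - 2 * ε) * u ≤ y := by
  have h₁ := h.le_m
  rw [hφ] at h₁
  linarith [h.m_le]

lemma LogBounds.y_le (h : LogBounds (φ ^ 2 - ε) C l y m u) (hφ : φ ^ 2 = φ + 1)
    (hφ₁ : 1.6 < φ) (hε : 0 < ε) (hε₁ : ε ≤ 1 / 100) (hC : C ≤ ε * y) (hy : 0 ≤ y) :
    y ≤ (φ - 1 + 2 * ε) * u := by
  have h₁ := h.le_u hφ hC
  have h₂ : 1 ≤ (φ - 1 + 2 * ε) * (φ - 2 * ε) := by nlinarith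
  calc y ≤ (φ - 1 + 2 * ε) * (φ - 2 * ε) * y := le_mul_of_one_le_left hy h₂
    _ = (φ - 1 + 2 * ε) * ((φ - 2 * ε) * y) := by ring
    _ ≤ _ := by gcongr; linarith

lemma LogBounds.le_u_of_next (h : LogBounds (φ ^ 2 - ε) C l y m u)
    (h' : LogBounds (φ ^ 2 - ε) C l' y' m' u') (hφ : φ ^ 2 = φ + 1)
    (hφ₁ : 1.6 < φ) (hφ₂ : φ < 1.62) (hε : 0 < ε) (hε₁ : ε ≤ 1 / 100) (hC : C ≤ ε * y)
    (hy : 0 ≤ y) (hum : u - m ≤ y' - l' + C) : (1 - 5 * ε) * y' ≤ u := by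
  have h₁ := h.y_le hφ hφ₁ hε hε₁ hC hy
  have hyu : y ≤ u := by nlinarith [h.le_u hφ hC]
  have h₂ : (φ - ε) * y' ≤ (φ + 4 * ε) * u := by
    have h₃ := h'.le_l
    rw [hφ] at h₃
    have h₄ : 2 * C ≤ 2 * ε * u := by nlinarith
    linarith [h.m_le]
  have hu : 0 ≤ u := hy.trans hyu
  have h₃ : (1 - 5 * ε) * (φ + 4 * ε) ≤ φ - ε := by nlinarith
  have h₄ : (φ - ε) * ((1 - 5 * ε) * y') ≤ (φ - ε) * u := by
    calc (φ - ε) * ((1 - 5 * ε) * y') = (1 - 5 * ε) * ((φ - ε) * y') := by ring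
      _ ≤ (1 - 5 * ε) * ((φ + 4 * ε) * u) := by gcongr; linarith
      _ = (1 - 5 * ε) * (φ + 4 * ε) * u := by ring
      _ ≤ (φ - ε) * u := by gcongr
  exact le_of_mul_le_mul_left h₄ (by linarith)

lemma LogBounds.le_m_of_le_u (h : LogBounds (φ ^ 2 - ε) C l y m u) (hφ : φ ^ 2 = φ + 1)
    (hφ₁ : 1.6 < φ) (hφ₂ : φ < 1.62) (hε : 0 < ε) (hε₁ : ε ≤ 1 / 100) (hy' : 0 ≤ y')
    (hu : (1 - 5 * ε) * y' ≤ u) : (φ ^ 2 - 15 * ε) * y' ≤ m := by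
  have h₁ : (φ ^ 2 - ε) * ((1 - 5 * ε) * y') ≤ (φ ^ 2 - ε) * u := by
    gcongr
    linarith
  have h₂ : φ ^ 2 - 15 * ε ≤ (φ ^ 2 - ε) * (1 - 5 * ε) := by nlinarith
  calc (φ ^ 2 - 15 * ε) * y' ≤ (φ ^ 2 - ε) * (1 - 5 * ε) * y' := by gcongr
    _ ≤ (φ ^ 2 - ε) * u := by linarith
    _ ≤ m := h.le_m

variable {l'' y'' m'' u'' : ℝ}

lemma LogBounds.chain (h : LogBounds (φ ^ 2 - ε) C l y m u)
    (h' : LogBounds (φ ^ 2 - ε) C l' y' m' u') (h'' : LogBounds (φ ^ 2 - ε) C l'' y'' m'' u'')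
    (hφ : φ ^ 2 = φ + 1) (hφ₁ : 1.6 < φ) (hφ₂ : φ < 1.62) (hε : 0 < ε) (hε₁ : ε ≤ 1 / 100)
    (hC : C ≤ ε * y) (hy : 0 ≤ y) (huy' : u ≤ y') (huy'' : u' ≤ y'')
    (hum : u - m ≤ y' - l' + C) (hum' : u' - m' ≤ y'' - l'' + C) :
    C + y + y' ≤ (1 + 6 * ε) * y'' ∧ (φ ^ 3 - 41 * ε) * y'' ≤ m'' - C ∧
      (φ ^ 3 - 41 * ε) * y'' ≤ m + m' := by
  have hyu : y ≤ u := by nlinarith [h.le_u hφ hC]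
  have hyy' : y ≤ y' := hyu.trans huy'
  have hC' : C ≤ ε * y' := hC.trans (by gcongr)
  have hy' : 0 ≤ y' := hy.trans hyy'
  have hyu' : y' ≤ u' := by nlinarith [h'.le_u hφ hC']
  have hyy'' : y' ≤ y'' := hyu'.trans huy''
  have hC'' : C ≤ ε * y'' := hC'.trans (by gcongr)
  have hy'' : 0 ≤ y'' := hy'.trans hyy''
  have hφ3 : φ ^ 3 = 2 * φ + 1 := by linear_combination (φ + 1) * hφ
  refine ⟨?_, ?_, ?_⟩
  · have a₁ : y' ≤ (φ - 1 + 2 * ε) * y'' :=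
      (h'.y_le hφ hφ₁ hε hε₁ hC' hy').trans (by gcongr; linarith)
    have a₂ : y ≤ (φ - 1 + 2 * ε) * y' :=
      (h.y_le hφ hφ₁ hε hε₁ hC hy).trans (by gcongr; linarith)
    have a₃ : y ≤ (φ - 1 + 2 * ε) * ((φ - 1 + 2 * ε) * y'') :=
      a₂.trans (by gcongr; linarith)
    have a₄ : (φ - 1 + 2 * ε) + (φ - 1 + 2 * ε) * (φ - 1 + 2 * ε) ≤ 1 + 5 * ε := by nlinarith
    have a₅ := mul_le_mul_of_nonneg_right a₄ hy''
    linarith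
  · have b₁ := h''.le_u hφ hC''
    have b₂ : φ ^ 3 - 40 * ε ≤ (φ ^ 2 - ε) * (φ - 2 * ε) := by nlinarith
    have b₃ : (φ ^ 2 - ε) * ((φ - 2 * ε) * y'') ≤ (φ ^ 2 - ε) * u'' := by
      gcongr; nlinarith
    have b₄ := mul_le_mul_of_nonneg_right b₂ hy''
    linarith [h''.le_m]
  · have c₁ := h'.le_u_of_next h'' hφ hφ₁ hφ₂ hε hε₁ hC' hy' hum'
    have c₂ := h'.le_m_of_le_u hφ hφ₁ hφ₂ hε hε₁ hy'' c₁
    have c₃ := h.le_u_of_next h' hφ hφ₁ hφ₂ hε hε₁ hC hy hum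
    have c₄ := h.le_m_of_le_u hφ hφ₁ hφ₂ hε hε₁ hy' c₃
    have c₅ := h'.le_y hφ (hC'.trans (by gcongr))
    have c₆ : (φ - 1 - 6 * ε) ≤ (φ - 1 - 2 * ε) * (1 - 5 * ε) := by nlinarith
    have c₇ : (φ - 1 - 6 * ε) * y'' ≤ y' := by
      calc (φ - 1 - 6 * ε) * y'' ≤ (φ - 1 - 2 * ε) * (1 - 5 * ε) * y'' := by gcongr
        _ = (φ - 1 - 2 * ε) * ((1 - 5 * ε) * y'') := by ring
        _ ≤ (φ - 1 - 2 * ε) * u' := by gcongr; linarith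
        _ ≤ y' := c₅
    have c₈ : (φ ^ 2 - 15 * ε) * ((φ - 1 - 6 * ε) * y'') ≤ (φ ^ 2 - 15 * ε) * y' := by
      gcongr; nlinarith
    have c₉ : φ - 26 * ε ≤ (φ ^ 2 - 15 * ε) * (φ - 1 - 6 * ε) := by
      rw [hφ]; nlinarith
    have c₁₀ := mul_le_mul_of_nonneg_right c₉ hy''
    nlinarith

end

/-! ### Approximation by products of minimal polynomials -/

section

variable {ζ : ℝ} {P : ℕ → Fin 3 → ℤ}

lemma IsMinSeq.abs_lf_pos (hζ : IsExtremal ζ) (hP : IsMinSeq ζ P) (k : ℕ) :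
    0 < |lf ζ (P k)| := abs_pos.mpr (lf_ne_zero hζ.1 (hP.ne_zero k))

lemma IsMinSeq.ht_pos (hP : IsMinSeq ζ P) (k : ℕ) : (0 : ℝ) < ht (P k) := by
  exact_mod_cast one_le_ht (hP.ne_zero k)

lemma IsMinSeq.eventually_logBounds (hζ : IsExtremal ζ) (hP : IsMinSeq ζ P) {w : ℝ}
    (hw : w < (3 + √5) / 2) : ∃ C₀ : ℝ, ∀ C ≥ C₀, ∀ᶠ k in Filter.atTop,
      det3 (P k) (P (k + 1)) (P (k + 2)) ≠ 0 →
        LogBounds w C (-Real.log |lf ζ (P k)|) (Real.log (ht (P (k + 1))))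
          (-Real.log |lf ζ (P (k + 1))|) (Real.log (ht (P (k + 2)))) := by
  obtain ⟨K, hK1, hK⟩ := one_le_of_res_ne_zero ζ
  obtain ⟨k₀, hk₀⟩ := exists_noRoot hζ.1 hP (hP.exists_lf_mul_ht_sq_le hζ)
  refine ⟨max (Real.log 6) (Real.log K), fun C hC => ?_⟩
  filter_upwards [hP.eventually_le_neg_log hζ hw, (Filter.tendsto_add_atTop_nat 1).eventually
    (hP.eventually_le_neg_log hζ hw), Filter.eventually_ge_atTop k₀] with k h₁ h₂ hk hdet
  have hC6 : Real.log 6 ≤ C := (le_max_left _ _).trans hC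
  have hCK : Real.log K ≤ C := (le_max_right _ _).trans hC
  have p₀ := hP.abs_lf_pos hζ k
  have p₁ := hP.abs_lf_pos hζ (k + 1)
  have q₁ := hP.ht_pos (k + 1)
  have q₂ := hP.ht_pos (k + 2)
  refine ⟨(Real.log_nonneg (by norm_num)).trans hC6, h₁, h₂, ?_, ?_⟩
  · have h := one_le_of_det3_ne_zero hdet (hP.ht_mono (by omega : k < k + 1)).le
      (hP.ht_mono (by omega : k + 1 < k + 2)).le (hP.lf_anti (by omega : k < k + 1)).le
      (hP.lf_anti (by omega : k < k + 2)).le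
    have hlog := Real.log_nonneg h
    rw [Real.log_mul (by positivity) (by positivity), Real.log_mul (by positivity) (by positivity),
      Real.log_mul (by positivity) (by positivity)] at hlog
    linarith
  · have hres : res (P (k + 1)) (P (k + 2)) ≠ 0 := fun h =>
      hP.not_prop2 (by omega : k + 1 < k + 2) (prop2_of_res_eq_zero (hk₀ _ (by omega)) h)
    have h := hK _ _ hres (hP.ht_mono (by omega : k + 1 < k + 2)).le
      (hP.lf_anti (by omega : k + 1 < k + 2)).le
    have hlog := Real.log_nonneg h
    rw [Real.log_mul (by positivity) (by positivity), Real.log_mul (by positivity) (by positivity),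
      Real.log_mul (by positivity) (by positivity), Real.log_pow] at hlog
    push_cast at hlog
    linarith

lemma IsMinSeq.exists_next (hζ : IsExtremal ζ) (hP : IsMinSeq ζ P) (a : ℕ) :
    ∃ b > a, det3 (P b) (P (b + 1)) (P (b + 2)) ≠ 0 ∧
      ∀ j, a + 1 ≤ j → j < b → det3 (P j) (P (j + 1)) (P (j + 2)) = 0 := by
  classical
  have hex := hP.exists_det3_ne_zero hζ.1 (hP.exists_lf_mul_ht_sq_le hζ) (a + 1)
  obtain ⟨h₁, h₂⟩ := Nat.find_spec hex
  refine ⟨Nat.find hex, h₁, h₂, fun j hj hjb => ?_⟩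
  by_contra h
  exact Nat.find_min hex hjb ⟨hj, h⟩

lemma IsMinSeq.log_le_of_next (hζ : IsExtremal ζ) (hP : IsMinSeq ζ P) {a b : ℕ} {C : ℝ}
    (hab : a < b) (h : ∀ j, a + 1 ≤ j → j < b → det3 (P j) (P (j + 1)) (P (j + 2)) = 0)
    (hC : 2 ≤ C) (hgap : Real.log (ht (P (a + 1))) + 1 ≤ Real.log (ht (P (a + 2)))) :
    Real.log (ht (P (a + 2))) - -Real.log |lf ζ (P (a + 1))|
      ≤ Real.log (ht (P (b + 1))) - -Real.log |lf ζ (P b)| + C := by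
  have hgap' : 2 * ht (P (a + 1)) ≤ ht (P (a + 2)) := by
    have h₀ := hP.ht_pos (a + 1)
    have : (2 * ht (P (a + 1)) : ℝ) ≤ ht (P (a + 2)) := by
      rw [← Real.log_le_log_iff (by positivity) (hP.ht_pos _),
        Real.log_mul two_ne_zero h₀.ne']
      linarith [Real.log_two_lt_d9]
    exact_mod_cast this
  have hle := hP.lf_mul_ht_le (hP.det3_eq_zero h b hab (by omega))
    (hP.det3_eq_zero h (b + 1) (by omega) le_rfl) hgap'
  have p₁ := hP.abs_lf_pos hζ (a + 1)
  have p₂ := hP.abs_lf_pos hζ b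
  have q₁ := hP.ht_pos (a + 2)
  have q₂ := hP.ht_pos (b + 1)
  have hlog := Real.log_le_log (by positivity) hle
  rw [Real.log_mul (by positivity) (by positivity), Real.log_mul (by positivity) (by positivity),
    Real.log_mul (by positivity) (by positivity)] at hlog
  have : Real.log 4 = 2 * Real.log 2 := by
    rw [← Real.log_rpow two_pos]; norm_num
  have h2 := Real.log_two_lt_d9
  have e : a + 1 + 1 = a + 2 := rfl
  rw [e] at hlog
  linarith

lemma IsMinSeq.exists_approx (hζ : IsExtremal ζ) (hP : IsMinSeq ζ P) {η : ℝ} (hη : η < 2 + √5)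
    {c : ℝ} (X₀ : ℝ) : ∃ E : ℝ, X₀ ≤ Real.exp E ∧ ∃ g h i : ℕ, g < i ∧ h < i ∧
      NoRoot (P i) ∧ 3 * ((ht (P g) : ℝ) * ht (P h)) ≤ Real.exp E ∧ ht (P i) ≤ Real.exp E ∧
      Real.exp c * |lf ζ (P i)| ≤ Real.exp (-η * E) ∧
      |lf ζ (P g)| * |lf ζ (P h)| ≤ Real.exp (-η * E) := by
  have hs : √5 ^ 2 = 5 := Real.sq_sqrt (by norm_num)
  have hs₁ : 2.2 < √5 := Real.lt_sqrt_of_sq_lt (by norm_num)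
  have hs₂ : √5 < 2.24 := (Real.sqrt_lt' (by norm_num)).mpr (by norm_num)
  obtain ⟨φ, hφ_def⟩ : ∃ φ, φ = (1 + √5) / 2 := ⟨_, rfl⟩
  have hφ : φ ^ 2 = φ + 1 := by rw [hφ_def]; linear_combination hs / 4
  have hφ2 : φ ^ 2 = (3 + √5) / 2 := by rw [hφ, hφ_def]; ring
  have hφ3 : φ ^ 3 = 2 + √5 := by linear_combination (φ + 1) * hφ + 2 * hφ_def
  have hφ₁ : 1.6 < φ := by rw [hφ_def]; linarith
  have hφ₂ : φ < 1.62 := by rw [hφ_def]; linarith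
  obtain ⟨ε, hε_def⟩ : ∃ ε, ε = min (1 / 100) ((2 + √5 - η) / 100) := ⟨_, rfl⟩
  have hε : 0 < ε := by rw [hε_def]; exact lt_min (by norm_num) (by linarith)
  have hε₁ : ε ≤ 1 / 100 := hε_def ▸ min_le_left _ _
  have hεη : 100 * ε ≤ 2 + √5 - η := by
    have : ε ≤ (2 + √5 - η) / 100 := hε_def ▸ min_le_right _ _
    linarith
  obtain ⟨C₀, hC₀⟩ := hP.eventually_logBounds hζ (w := φ ^ 2 - ε) (by linarith)
  obtain ⟨C, hC, hC2, hCc⟩ : ∃ C, C₀ ≤ C ∧ 2 ≤ C ∧ c ≤ C :=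
    ⟨max C₀ (max 2 c), le_max_left _ _, (le_max_left _ _).trans (le_max_right _ _),
      (le_max_right _ _).trans (le_max_right _ _)⟩
  obtain ⟨k₁, hk₁⟩ := exists_noRoot hζ.1 hP (hP.exists_lf_mul_ht_sq_le hζ)
  have hx := hP.tendsto_log_ht.comp (Filter.tendsto_add_atTop_nat 1)
  obtain ⟨k₀, hk₀⟩ := Filter.eventually_atTop.mp ((hC₀ C hC).and
    ((hx.eventually_ge_atTop (C / ε)).and ((hx.eventually_ge_atTop X₀).and
      (Filter.eventually_ge_atTop k₁))))
  simp only [Function.comp_apply] at hk₀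
  obtain ⟨g, hg, hdg, -⟩ := hP.exists_next hζ k₀
  obtain ⟨h, hgh, hdh, hnh⟩ := hP.exists_next hζ g
  obtain ⟨i, hhi, hdi, hni⟩ := hP.exists_next hζ h
  have Bg := (hk₀ g (by omega)).1 hdg
  have Bh := (hk₀ h (by omega)).1 hdh
  have Bi := (hk₀ i (by omega)).1 hdi
  have hCg {k : ℕ} (hk : k₀ ≤ k) : C ≤ ε * Real.log (ht (P (k + 1))) := by
    have := (hk₀ k hk).2.1
    rw [div_le_iff₀ hε] at this
    linarith
  have hpos {k : ℕ} (hk : k₀ ≤ k) : 200 ≤ Real.log (ht (P (k + 1))) := by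
    nlinarith [hCg hk]
  have hgap {k : ℕ} (hk : k₀ ≤ k) (hdk : det3 (P k) (P (k + 1)) (P (k + 2)) ≠ 0) :
      Real.log (ht (P (k + 1))) + 1 ≤ Real.log (ht (P (k + 2))) := by
    have := ((hk₀ k hk).1 hdk).le_u hφ (hCg hk)
    nlinarith [hpos hk]
  have hlog_mono {a b : ℕ} (hab : a ≤ b) : Real.log (ht (P a)) ≤ Real.log (ht (P b)) :=
    Real.log_le_log (hP.ht_pos a) (by exact_mod_cast hP.ht_mono.monotone hab)
  have hmain := Bg.chain Bh Bi hφ hφ₁ hφ₂ hε hε₁ (hCg hg.le) (by linarith [hpos hg.le])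
    (hlog_mono (by omega)) (hlog_mono (by omega))
    (hP.log_le_of_next hζ hgh hnh hC2 (hgap hg.le hdg))
    (hP.log_le_of_next hζ hhi hni hC2 (hgap (by omega) hdh))
  have hT := hpos (k := i) (by omega)
  have hXT := (hk₀ i (by omega)).2.2.1
  have hTi : Real.exp (Real.log (ht (P (i + 1)))) = ht (P (i + 1)) := Real.exp_log (hP.ht_pos _)
  set T := Real.log (ht (P (i + 1)))
  obtain ⟨m₁, m₂, m₃⟩ := hmain
  have hηT : η * ((1 + 6 * ε) * T) ≤ (φ ^ 3 - 41 * ε) * T := by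
    have : η * (1 + 6 * ε) ≤ φ ^ 3 - 41 * ε := by rw [hφ3]; nlinarith
    nlinarith
  have hTE : T ≤ (1 + 6 * ε) * T := by nlinarith
  refine ⟨(1 + 6 * ε) * T, ?_, g + 1, h + 1, i + 1, by omega, by omega,
    hk₁ _ (by have := (hk₀ i (by omega)).2.2.2; omega), ?_, ?_, ?_, ?_⟩
  · linarith [Real.add_one_le_exp ((1 + 6 * ε) * T)]
  · rw [← Real.exp_log (hP.ht_pos (g + 1)), ← Real.exp_log (hP.ht_pos (h + 1))]
    have h3 : (3 : ℝ) ≤ Real.exp C := by linarith [Real.add_one_le_exp C]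
    calc _ ≤ Real.exp C * (Real.exp (Real.log (ht (P (g + 1))))
          * Real.exp (Real.log (ht (P (h + 1))))) := by gcongr
      _ ≤ _ := by
        rw [← Real.exp_add, ← Real.exp_add]
        exact Real.exp_le_exp.mpr (by linarith)
  · rw [← hTi]
    exact Real.exp_le_exp.mpr hTE
  · rw [← Real.exp_log (hP.abs_lf_pos hζ (i + 1)), ← Real.exp_add]
    exact Real.exp_le_exp.mpr (by linarith)
  · rw [← Real.exp_log (hP.abs_lf_pos hζ (g + 1)), ← Real.exp_log (hP.abs_lf_pos hζ (h + 1)),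
      ← Real.exp_add]
    exact Real.exp_le_exp.mpr (by linarith)

end

theorem extremal_w44_lower (ζ : ℝ) (hζ : IsExtremal ζ) :
    ∀ η : ℝ, η < 2 + Real.sqrt 5 → ∀ X₀ : ℝ, ∃ X : ℝ, X₀ ≤ X ∧
      ∃ P : Fin 4 → Polynomial ℤ, LinearIndependent ℤ P ∧ ∀ i : Fin 4,
        (P i).natDegree ≤ 4 ∧ polyH (P i) ≤ X ∧
        0 < |pev ζ (P i)| ∧ |pev ζ (P i)| ≤ X ^ (-η) := by
  intro η hη X₀
  obtain ⟨P, hP⟩ := exists_isMinSeq_of_isExtremal hζ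
  obtain ⟨E, hE, g, h, i, hgi, hhi, hroot, hht, hhti, hlfi, hlf⟩ :=
    hP.exists_approx hζ hη (c := Real.log (1 + |ζ| + ζ ^ 2)) X₀
  rw [Real.exp_log (by positivity)] at hlfi
  have hprop {j : ℕ} (hj : j < i) : ¬ Prop2 (P i) (P j) := by
    rintro ⟨h₀, h₁, h₂⟩
    exact hP.not_prop2 hj ⟨by linear_combination -h₀, by linear_combination -h₁,
      by linear_combination -h₂⟩
  have hζ0 : ζ ≠ 0 := by
    rintro rfl
    exact hζ.1 isAlgebraic_zero
  have hX : Real.exp E ^ (-η) = Real.exp (-η * E) := by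
    rw [← Real.exp_mul, mul_comm]
  have hfst (j : ℕ) (hj : j ≤ 2) : (X ^ j * toPoly (P i)).natDegree ≤ 4 ∧
      polyH (X ^ j * toPoly (P i)) ≤ Real.exp E ∧ 0 < |pev ζ (X ^ j * toPoly (P i))| ∧
      |pev ζ (X ^ j * toPoly (P i))| ≤ Real.exp E ^ (-η) := by
    have e : pev ζ (X ^ j * toPoly (P i)) = ζ ^ j * lf ζ (P i) := by
      simp [pev, aeval_toPoly]
    refine ⟨?_, polyH_le (Real.exp_pos E).le fun n =>
      (abs_coeff_X_pow_mul_toPoly_le _ j n).trans hhti, ?_, ?_⟩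
    · have := natDegree_mul_le (p := (X : ℤ[X]) ^ j) (q := toPoly (P i))
      have := natDegree_toPoly_le (P i)
      rw [natDegree_X_pow] at *
      omega
    · rw [e]
      exact abs_pos.mpr (mul_ne_zero (pow_ne_zero j hζ0) (lf_ne_zero hζ.1 (hP.ne_zero i)))
    · rw [e, hX, abs_mul, abs_pow]
      refine le_trans ?_ hlfi
      gcongr
      have := abs_nonneg ζ
      have := sq_abs ζ
      interval_cases j <;> nlinarith
  refine ⟨Real.exp E, hE, _, linearIndependent_of_noRoot hroot (hprop hgi) (hprop hhi), ?_⟩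
  have hlst : (toPoly (P g) * toPoly (P h)).natDegree ≤ 4 ∧
      polyH (toPoly (P g) * toPoly (P h)) ≤ Real.exp E ∧
      0 < |pev ζ (toPoly (P g) * toPoly (P h))| ∧
      |pev ζ (toPoly (P g) * toPoly (P h))| ≤ Real.exp E ^ (-η) := by
    have e : pev ζ (toPoly (P g) * toPoly (P h)) = lf ζ (P g) * lf ζ (P h) := by
      simp [pev, aeval_toPoly]
    refine ⟨natDegree_mul_le.trans
      (add_le_add (natDegree_toPoly_le (P g)) (natDegree_toPoly_le (P h))),
      polyH_le (Real.exp_pos E).le fun n => (abs_coeff_mul_toPoly_le _ _ n).trans hht, ?_, ?_⟩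
    · rw [e]
      exact abs_pos.mpr (mul_ne_zero (lf_ne_zero hζ.1 (hP.ne_zero g))
        (lf_ne_zero hζ.1 (hP.ne_zero h)))
    · rwa [e, hX, abs_mul]
  intro j
  fin_cases j
  · exact hfst 0 (by norm_num)
  · exact hfst 1 (by norm_num)
  · exact hfst 2 (by norm_num)
  · exact hlst
end
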